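/- arXiv:1510.08920 — 10 statements merged into one kernel-verified Lean document; each statement's English description precedes it below -/
import Mathlib

section
/- Let {X_t : t=0,1,2,...} be a homogeneous real-valued Markov chain with transition kernel π satisfying assumptions A1 and A2, and let g : ℝ → ℝ be bounded and continuous. Then, for every t=1,2,..., as v ↑ ∞, the integral ∫_ℝ g(y) π(a_t(v)+b_t(v)x, a_{t+1}(v)+b_{t+1}(v)dy) converges to ∫_ℝ g(ψ^a_{t+1}(x)+ψ^b_{t+1}(x)y) K(dy), and the convergence holds uniformly on compact sets in the variable x ∈ ℝ. -/
open MeasureTheory ProbabilityTheory Filter Topology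
open scoped BoundedContinuousFunction

/-- If `μ i` converges weakly to `ν` and `p i → p₀`, then the integrals of a jointly continuous
bounded function `h (p i) y` against `μ i` converge to its integral at `p₀` against `ν`. -/
theorem tendsto_integral_param_of_tendsto {ι E F : Type*} {l : Filter ι}
    [TopologicalSpace E] [TopologicalSpace.PseudoMetrizableSpace E]
    [SecondCountableTopology E] [MeasurableSpace E] [BorelSpace E]
    [TopologicalSpace F] [TopologicalSpace.PseudoMetrizableSpace F]
    [SecondCountableTopology F] [MeasurableSpace F] [BorelSpace F]
    {μ : ι → ProbabilityMeasure F} {ν : ProbabilityMeasure F} {p : ι → E} {p₀ : E}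
    (hμ : Tendsto μ l (𝓝 ν)) (hp : Tendsto p l (𝓝 p₀)) (h : E × F →ᵇ ℝ) :
    Tendsto (fun i => ∫ y, h (p i, y) ∂(μ i : Measure F)) l
      (𝓝 (∫ y, h (p₀, y) ∂(ν : Measure F))) := by
  have hprod : Tendsto (fun i => (diracProba (p i)).prod (μ i)) l
      (𝓝 ((diracProba p₀).prod ν)) :=
    (ProbabilityMeasure.continuous_prod.tendsto (diracProba p₀, ν)).comp
      (((continuous_diracProba.tendsto p₀).comp hp).prodMk_nhds hμ)
  have hint := ProbabilityMeasure.tendsto_iff_forall_integral_tendsto.1 hprod h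
  have key (q : E) (m : ProbabilityMeasure F) :
      ∫ z, h z ∂((diracProba q).prod m : Measure (E × F)) = ∫ y, h (q, y) ∂(m : Measure F) := by
    rw [ProbabilityMeasure.toMeasure_prod]
    change ∫ z, h z ∂((Measure.dirac q).prod (m : Measure F)) = _
    rw [Measure.dirac_prod, integral_map measurable_prodMk_left.aemeasurable
      h.continuous.aestronglyMeasurable]
  simpa only [key] using hint

/-- Local uniform convergence to a continuous limit amounts to joint convergence at each point. -/
theorem tendstoUniformlyOn_of_forall_tendsto_prod {ι α β : Type*} [TopologicalSpace α]
    [UniformSpace β] {F : ι → α → β} {f : α → β} {p : Filter ι} {C : Set α}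
    (hC : IsCompact C) (hf : ContinuousOn f C)
    (h : ∀ x ∈ C, Tendsto (fun q : ι × α => F q.1 q.2) (p ×ˢ 𝓝[C] x) (𝓝 (f x))) :
    TendstoUniformlyOn F f p C := by
  rw [← tendstoLocallyUniformlyOn_iff_tendstoUniformlyOn_of_compact hC,
    tendstoLocallyUniformlyOn_iff_forall_tendsto]
  intro x hx
  exact (((hf x hx).tendsto.comp tendsto_snd).prodMk_nhds (h x hx)).mono_right
    (nhds_le_uniformity (f x))

theorem TendstoUniformlyOn.tendsto_prod_nhdsWithin {ι α β : Type*} [TopologicalSpace α]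
    [UniformSpace β] {F : ι → α → β} {c : β} {p : Filter ι} {C : Set α}
    (h : TendstoUniformlyOn F (fun _ => c) p C) (x : α) :
    Tendsto (fun q : ι × α => F q.1 q.2) (p ×ˢ 𝓝[C] x) (𝓝 c) := by
  rw [Uniform.tendsto_nhds_right]
  exact (tendstoUniformlyOn_iff_tendsto.1 h).mono_left
    (prod_mono le_rfl (le_principal_iff.2 self_mem_nhdsWithin))

/-- The law of `(Y - m) / s` when `Y` has law `π w`. -/
noncomputable def normedLaw (π : Kernel ℝ ℝ) [IsMarkovKernel π] (m s w : ℝ) :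
    ProbabilityMeasure ℝ :=
  ⟨(π w).map (fun y => (y - m) / s), Measure.isProbabilityMeasure_map (by fun_prop)⟩

theorem integral_normedLaw (π : Kernel ℝ ℝ) [IsMarkovKernel π] (m s w : ℝ) {f : ℝ → ℝ}
    (hf : Continuous f) :
    ∫ z, f z ∂(normedLaw π m s w : Measure ℝ) = ∫ y, f ((y - m) / s) ∂(π w) :=
  integral_map (by fun_prop) hf.aestronglyMeasurable

/-- Lemma 1 (induction step, location-scale case): under assumptions A1 and A2, for every
`t ≥ 1` and every bounded continuous `g : ℝ → ℝ`,
`∫ g(y) π(aN t v + bN t v * x, aN (t+1) v + bN (t+1) v * dy)` converges, as `v → ∞`, to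
`∫ g(ψa t x + ψb t x * y) K(dy)`, uniformly on compact sets in the variable `x ∈ ℝ`. -/
theorem extreme_events_lemma_induction_step
    (π : Kernel ℝ ℝ) (hπ : IsMarkovKernel π)
    (K : Measure ℝ) (hK : IsProbabilityMeasure K)
    (hKnondeg : ∀ x : ℝ, K ≠ Measure.dirac x)
    -- norming functions `aN t`, `bN t` for `t = 1, 2, ...` (with `aN 1 = a`, `bN 1 = b`)
    (aN : ℕ → ℝ → ℝ) (bN : ℕ → ℝ → ℝ)
    (haNmeas : ∀ t, 1 ≤ t → Measurable (aN t)) (hbNmeas : ∀ t, 1 ≤ t → Measurable (bN t))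
    (hbNpos : ∀ t, 1 ≤ t → ∀ v, 0 < bN t v)
    -- Assumption A1: `π(v, a(v) + b(v)·dx)` converges weakly to `K` as `v → ∞`
    (hA1 : ∀ f : BoundedContinuousFunction ℝ ℝ,
      Tendsto (fun v => ∫ y, f ((y - aN 1 v) / bN 1 v) ∂(π v)) atTop (𝓝 (∫ y, f y ∂K)))
    -- Assumption A2 (a): `aN t v + bN t v * x → ∞` as `v → ∞`, for every `x`
    (hA2a : ∀ t, 1 ≤ t → ∀ x : ℝ, Tendsto (fun v => aN t v + bN t v * x) atTop atTop)
    -- Assumption A2 (b): continuous update functions `ψa t`, `ψb t` arising as limits,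
    -- with remainder terms converging to `0` uniformly on compact sets in `x`
    (ψa : ℕ → ℝ → ℝ) (ψb : ℕ → ℝ → ℝ)
    (hψacont : ∀ t, 1 ≤ t → Continuous (ψa t)) (hψbcont : ∀ t, 1 ≤ t → Continuous (ψb t))
    (hψbpos : ∀ t, 1 ≤ t → ∀ x, 0 < ψb t x)
    (hψalim : ∀ t, 1 ≤ t → ∀ x : ℝ,
      Tendsto (fun v => (aN 1 (aN t v + bN t v * x) - aN (t + 1) v) / bN (t + 1) v)
        atTop (𝓝 (ψa t x)))
    (hψblim : ∀ t, 1 ≤ t → ∀ x : ℝ,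
      Tendsto (fun v => bN 1 (aN t v + bN t v * x) / bN (t + 1) v) atTop (𝓝 (ψb t x)))
    (hra : ∀ t, 1 ≤ t → ∀ C : Set ℝ, IsCompact C →
      TendstoUniformlyOn
        (fun v x => (aN (t + 1) v - aN 1 (aN t v + bN t v * x) + bN (t + 1) v * ψa t x)
          / bN 1 (aN t v + bN t v * x))
        (fun _ => 0) atTop C)
    (hrb : ∀ t, 1 ≤ t → ∀ C : Set ℝ, IsCompact C →
      TendstoUniformlyOn
        (fun v x => 1 - bN (t + 1) v * ψb t x / bN 1 (aN t v + bN t v * x))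
        (fun _ => 0) atTop C)
    -- a bounded continuous function `g`
    (g : ℝ → ℝ) (hgcont : Continuous g) (Mg : ℝ) (hgbdd : ∀ x, |g x| ≤ Mg) :
    ∀ t, 1 ≤ t → ∀ C : Set ℝ, IsCompact C →
      TendstoUniformlyOn
        (fun v x => ∫ y, g ((y - aN (t + 1) v) / bN (t + 1) v) ∂(π (aN t v + bN t v * x)))
        (fun x => ∫ y, g (ψa t x + ψb t x * y) ∂K) atTop C := by
  intro t ht C hC
  have hψa := hψacont t ht
  have hψb := hψbcont t ht
  have hb1 := hbNpos 1 le_rfl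
  have hbt1 := hbNpos (t + 1) (by omega)
  have hcont : Continuous fun q : (ℝ × ℝ) × ℝ => g (q.1.1 + q.1.2 * q.2) := by fun_prop
  let h : BoundedContinuousFunction ((ℝ × ℝ) × ℝ) ℝ :=
    BoundedContinuousFunction.ofNormedAddCommGroup _ hcont Mg fun q => hgbdd _
  let ν : ProbabilityMeasure ℝ := ⟨K, hK⟩
  refine tendstoUniformlyOn_of_forall_tendsto_prod hC ?_ fun x hx => ?_
  · refine Continuous.continuousOn (continuous_iff_continuousAt.2 fun x => ?_)
    exact tendsto_integral_param_of_tendsto (μ := fun _ => ν) tendsto_const_nhds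
      ((hψa.prodMk hψb).tendsto x) h
  set l : Filter (ℝ × ℝ) := atTop ×ˢ 𝓝[C] x
  let c : ℝ × ℝ → ℝ := fun q => aN t q.1 + bN t q.1 * q.2
  have hsnd : Tendsto (fun q : ℝ × ℝ => q.2) l (𝓝 x) :=
    tendsto_snd.mono_right nhdsWithin_le_nhds
  have hc : Tendsto c l atTop := by
    refine tendsto_atTop_mono' l ?_ ((hA2a t ht (x - 1)).comp tendsto_fst)
    filter_upwards [hsnd.eventually (lt_mem_nhds (sub_one_lt x))] with q hq
    have := mul_le_mul_of_nonneg_left hq.le (hbNpos t ht q.1).le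
    simpa [c] using this
  have hlaw : Tendsto (fun w => normedLaw π (aN 1 w) (bN 1 w) w) atTop (𝓝 ν) := by
    rw [ProbabilityMeasure.tendsto_iff_forall_integral_tendsto]
    intro f
    simp only [integral_normedLaw π _ _ _ f.continuous]
    exact hA1 f
  have hψb_lim : Tendsto (fun q => ψb t q.2) l (𝓝 (ψb t x)) := (hψb.tendsto x).comp hsnd
  have hψa_lim : Tendsto (fun q => ψa t q.2) l (𝓝 (ψa t x)) := (hψa.tendsto x).comp hsnd
  have hB : Tendsto (fun q => bN 1 (c q) / bN (t + 1) q.1) l (𝓝 (ψb t x)) := by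
    have hr := ((hrb t ht C hC).tendsto_prod_nhdsWithin x).const_sub 1
    have hdiv := hψb_lim.div hr (by norm_num)
    rw [sub_zero, div_one] at hdiv
    refine hdiv.congr fun q => ?_
    have h1 := (hψbpos t ht q.2).ne'
    have h2 := (hb1 (c q)).ne'
    have h3 := (hbt1 q.1).ne'
    simp only [c] at h2 ⊢
    simp only [Pi.div_apply, sub_sub_cancel]
    field_simp
  have hA : Tendsto (fun q => (aN 1 (c q) - aN (t + 1) q.1) / bN (t + 1) q.1) l
      (𝓝 (ψa t x)) := by
    have hr := ((hra t ht C hC).tendsto_prod_nhdsWithin x).mul hB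
    have hsub := hψa_lim.sub hr
    rw [zero_mul, sub_zero] at hsub
    refine hsub.congr fun q => ?_
    have h2 := (hb1 (c q)).ne'
    have h3 := (hbt1 q.1).ne'
    simp only [c] at h2 ⊢
    field_simp
    ring
  refine (tendsto_integral_param_of_tendsto (hlaw.comp hc) (hA.prodMk_nhds hB) h).congr
    fun q => ?_
  refine (integral_normedLaw π _ _ _ (f := fun z => h (_, z)) (by fun_prop)).trans ?_
  refine integral_congr_ae (.of_forall fun y => congrArg g ?_)
  have h2 := (hb1 (c q)).ne'
  have h3 := (hbt1 q.1).ne'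
  simp only
  field_simp
  ring
end

section
/- Let {X_t : t=0,1,2,...} be a non-negative homogeneous Markov chain with transition kernel π satisfying assumptions B1 and B2(a),(b), and let g : [0,∞) → ℝ be bounded and continuous. Then, for every t=1,2,..., as v ↑ ∞, the integral ∫_{[0,∞)} g(y) π(b_t(v)x, b_{t+1}(v)dy) converges to ∫_{[0,∞)} g(ψ^b_{t+1}(x)y) K(dy), and the convergence holds uniformly on compact sets in the variable x ∈ [δ,∞) for every δ > 0. -/
open MeasureTheory ProbabilityTheory Filter Topology

/-- Joint continuity of scaled integrals: if `μs i` converges weakly to `μ` and `a i → a₀`, then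
`∫ g (a i * y) ∂(μs i)` converges to `∫ g (a₀ * y) ∂μ` for bounded continuous `g`. -/
theorem ProbabilityMeasure.tendsto_integral_comp_mul {ι : Type*} {l : Filter ι}
    {μs : ι → ProbabilityMeasure ℝ} {μ : ProbabilityMeasure ℝ} (hμ : Tendsto μs l (𝓝 μ))
    {a : ι → ℝ} {a₀ : ℝ} (ha : Tendsto a l (𝓝 a₀)) (g : BoundedContinuousFunction ℝ ℝ) :
    Tendsto (fun i => ∫ y, g (a i * y) ∂(μs i : Measure ℝ)) l
      (𝓝 (∫ y, g (a₀ * y) ∂(μ : Measure ℝ))) := by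
  have hprod : Tendsto (fun i => (diracProba (a i)).prod (μs i)) l
      (𝓝 ((diracProba a₀).prod μ)) :=
    (ProbabilityMeasure.continuous_prod.tendsto (diracProba a₀, μ)).comp
      (((continuous_diracProba.tendsto a₀).comp ha).prodMk_nhds hμ)
  have hint (c : ℝ) (ν : ProbabilityMeasure ℝ) :
      ∫ p, g (p.1 * p.2) ∂((diracProba c).prod ν : Measure (ℝ × ℝ)) =
        ∫ y, g (c * y) ∂(ν : Measure ℝ) := by
    rw [ProbabilityMeasure.toMeasure_prod]
    change ∫ p, g (p.1 * p.2) ∂((Measure.dirac c).prod (ν : Measure ℝ)) = _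
    rw [Measure.dirac_prod, integral_map (by fun_prop)
      (Continuous.aestronglyMeasurable (by fun_prop))]
  simpa only [BoundedContinuousFunction.compContinuous_apply, ContinuousMap.coe_mk, hint] using
    ProbabilityMeasure.tendsto_iff_forall_integral_tendsto.1 hprod
      (g.compContinuous ⟨fun p : ℝ × ℝ => p.1 * p.2, continuous_mul⟩)

/-- Lemma 2 (induction step, scale-only case): for a non-negative chain, under assumptions
B1 and B2(a),(b), for every `t ≥ 1` and bounded continuous `g : [0,∞) → ℝ` (formalized as
a bounded continuous `g : ℝ → ℝ` used on `[0,∞)`),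
`∫_{[0,∞)} g(y) π(bN t v * x, bN (t+1) v * dy)` converges, as `v → ∞`, to
`∫_{[0,∞)} g(ψb t x * y) K(dy)`, uniformly on compact sets in `x ∈ [δ,∞)` for every
`δ > 0`. -/
theorem extreme_events_lemma_induction_step_nonneg
    (π : Kernel ℝ ℝ) (hπ : IsMarkovKernel π)
    (hπnonneg : ∀ x : ℝ, (π x) (Set.Iio (0 : ℝ)) = 0)
    (K : Measure ℝ) (hK : IsProbabilityMeasure K)
    (hKnonneg : K (Set.Iio (0 : ℝ)) = 0) (hKzero : K {(0 : ℝ)} = 0)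
    (hKnondeg : ∀ x : ℝ, K ≠ Measure.dirac x)
    -- norming functions `bN t` for `t = 1, 2, ...` (with `bN 1 = b`)
    (bN : ℕ → ℝ → ℝ)
    (hbNmeas : ∀ t, 1 ≤ t → Measurable (bN t)) (hbNpos : ∀ t, 1 ≤ t → ∀ v, 0 < bN t v)
    -- Assumption B1: `π(v, b(v)·dx)` converges weakly to `K` as `v → ∞`
    (hB1 : ∀ f : BoundedContinuousFunction ℝ ℝ,
      Tendsto (fun v => ∫ y, f (y / bN 1 v) ∂(π v)) atTop (𝓝 (∫ y, f y ∂K)))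
    -- Assumption B2 (a): `bN t v → ∞` as `v → ∞`
    (hB2a : ∀ t, 1 ≤ t → Tendsto (bN t) atTop atTop)
    -- Assumption B2 (b): continuous update functions `ψb t` on `(0,∞)` arising as limits,
    -- with remainder terms converging to `0` uniformly on compacts in `[δ,∞)`, all `δ > 0`
    (ψb : ℕ → ℝ → ℝ)
    (hψbcont : ∀ t, 1 ≤ t → ContinuousOn (ψb t) (Set.Ioi 0))
    (hψbpos : ∀ t, 1 ≤ t → ∀ x, 0 < x → 0 < ψb t x)
    (hψblim : ∀ t, 1 ≤ t → ∀ x : ℝ, 0 < x →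
      Tendsto (fun v => bN 1 (bN t v * x) / bN (t + 1) v) atTop (𝓝 (ψb t x)))
    (hrb : ∀ t, 1 ≤ t → ∀ δ : ℝ, 0 < δ → ∀ C : Set ℝ, IsCompact C → C ⊆ Set.Ici δ →
      TendstoUniformlyOn
        (fun v x => 1 - bN (t + 1) v * ψb t x / bN 1 (bN t v * x))
        (fun _ => 0) atTop C)
    -- a bounded continuous function `g`
    (g : ℝ → ℝ) (hgcont : Continuous g) (Mg : ℝ) (hgbdd : ∀ x, |g x| ≤ Mg) :
    ∀ t, 1 ≤ t → ∀ δ : ℝ, 0 < δ → ∀ C : Set ℝ, IsCompact C → C ⊆ Set.Ici δ →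
      TendstoUniformlyOn
        (fun v x => ∫ y, g (y / bN (t + 1) v) ∂(π (bN t v * x)))
        (fun x => ∫ y, g (ψb t x * y) ∂K) atTop C := by
  intro t ht δ hδ C hC hCδ
  have hCpos {x : ℝ} (hx : x ∈ C) : 0 < x := hδ.trans_le (hCδ hx)
  let G : BoundedContinuousFunction ℝ ℝ := .ofNormedAddCommGroup g hgcont Mg hgbdd
  let K' : ProbabilityMeasure ℝ := ⟨K, hK⟩
  let law (u : ℝ) : ProbabilityMeasure ℝ :=
    ⟨(π u).map (· / bN 1 u), Measure.isProbabilityMeasure_map (by fun_prop)⟩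
  have law_integral (u : ℝ) (f : ℝ → ℝ) (hf : Continuous f) :
      ∫ y, f y ∂(law u : Measure ℝ) = ∫ y, f (y / bN 1 u) ∂(π u) :=
    integral_map (by fun_prop) hf.aestronglyMeasurable
  have law_tendsto : Tendsto law atTop (𝓝 K') := by
    refine ProbabilityMeasure.tendsto_iff_forall_integral_tendsto.2 fun f => ?_
    simp only [law_integral _ _ f.continuous]
    exact hB1 f
  rw [← tendstoLocallyUniformlyOn_iff_tendstoUniformlyOn_of_compact hC,
    tendstoLocallyUniformlyOn_iff_forall_tendsto]
  intro x hx
  have hψ : Tendsto (fun p : ℝ × ℝ => ψb t p.2) (atTop ×ˢ 𝓝[C] x) (𝓝 (ψb t x)) :=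
    ((hψbcont t ht x (hCpos hx)).mono fun _ => hCpos).tendsto.comp tendsto_snd
  have hmem : ∀ᶠ p : ℝ × ℝ in atTop ×ˢ 𝓝[C] x, p.2 ∈ C :=
    tendsto_snd.eventually self_mem_nhdsWithin
  have hu : Tendsto (fun p : ℝ × ℝ => bN t p.1 * p.2) (atTop ×ˢ 𝓝[C] x) atTop :=
    ((hB2a t ht).comp tendsto_fst).atTop_mul_pos (hCpos hx)
      ((tendsto_id.mono_left nhdsWithin_le_nhds).comp tendsto_snd)
  have hr : Tendsto (fun p : ℝ × ℝ => 1 - bN (t + 1) p.1 * ψb t p.2 / bN 1 (bN t p.1 * p.2))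
      (atTop ×ˢ 𝓝[C] x) (𝓝 0) :=
    (Uniform.tendsto_nhds_right.2 (tendstoUniformlyOn_iff_tendsto.1
      (hrb t ht δ hδ C hC hCδ))).mono_left
      (Filter.prod_mono le_rfl inf_le_right)
  have hratio : Tendsto (fun p : ℝ × ℝ => bN 1 (bN t p.1 * p.2) / bN (t + 1) p.1)
      (atTop ×ˢ 𝓝[C] x) (𝓝 (ψb t x)) := by
    have h := hψ.div (hr.const_sub 1) (by norm_num)
    rw [sub_zero, div_one] at h
    refine h.congr' (hmem.mono fun p hp => ?_)
    have h1 := (hbNpos 1 le_rfl (bN t p.1 * p.2)).ne'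
    have h2 := (hbNpos (t + 1) (by omega) p.1).ne'
    have h3 := (hψbpos t ht p.2 (hCpos hp)).ne'
    simp only [Pi.div_apply, sub_sub_cancel]
    field_simp
  have hlim := ProbabilityMeasure.tendsto_integral_comp_mul (law_tendsto.comp hu) hratio G
  have hlim' := ProbabilityMeasure.tendsto_integral_comp_mul
    (tendsto_const_nhds (x := K')) hψ G
  have hcongr (p : ℝ × ℝ) :
      ∫ y, G (bN 1 (bN t p.1 * p.2) / bN (t + 1) p.1 * y) ∂(law (bN t p.1 * p.2) : Measure ℝ) =
        ∫ y, g (y / bN (t + 1) p.1) ∂(π (bN t p.1 * p.2)) := by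
    rw [law_integral _ (fun y => G (bN 1 (bN t p.1 * p.2) / bN (t + 1) p.1 * y)) (by fun_prop)]
    have h1 := (hbNpos 1 le_rfl (bN t p.1 * p.2)).ne'
    refine integral_congr_ae (.of_forall fun y => congrArg g ?_)
    field_simp
  simp only [Function.comp_apply, hcongr] at hlim
  exact (hlim'.prodMk_nhds hlim).mono_right (nhds_le_uniformity _)
end

section
/- Let (E,d) be a complete, locally compact, separable metric space and let μ_n be a sequence of probability measures on E converging weakly to a probability measure μ. Let φ_n be a uniformly bounded sequence of measurable real-valued functions on E which converges uniformly on compact sets of E to a continuous function φ. Then φ is bounded on E and ∫_E φ_n dμ_n → ∫_E φ dμ as n → ∞. -/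
open MeasureTheory Filter Topology

/-- On a locally compact metric space, any finite measure is, up to `ε`, carried by a
`[0, 1]`-valued continuous function with compact support. -/
lemma exists_hasCompactSupport_integral_one_sub_lt
    {E : Type*} [MetricSpace E] [CompleteSpace E] [LocallyCompactSpace E]
    [TopologicalSpace.SeparableSpace E] [MeasurableSpace E] [BorelSpace E]
    (μ : Measure E) [IsFiniteMeasure μ] {ε : ℝ} (hε : 0 < ε) :
    ∃ g : C(E, ℝ), HasCompactSupport g ∧ (∀ x, g x ∈ Set.Icc (0 : ℝ) 1) ∧
      ∫ x, (1 - g x) ∂μ < ε := by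
  have : SecondCountableTopology E := UniformSpace.secondCountable_of_separable E
  obtain ⟨K, hK, hKμ⟩ := isTightMeasureSet_iff_exists_isCompact_measure_compl_le.1
    (isTightMeasureSet_singleton (μ := μ)) (ENNReal.ofReal (ε / 2)) (by simpa using hε)
  obtain ⟨g, hg1, -, hgc, hg⟩ := exists_continuous_one_zero_of_isCompact hK isClosed_empty
    (Set.disjoint_empty K)
  refine ⟨g, hgc, hg, ?_⟩
  have hKm : MeasurableSet Kᶜ := hK.measurableSet.compl
  calc ∫ x, (1 - g x) ∂μ ≤ ∫ x, Kᶜ.indicator 1 x ∂μ := by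
        refine integral_mono_of_nonneg (.of_forall fun x => sub_nonneg.2 (hg x).2)
          ((integrable_const 1).indicator hKm) (.of_forall fun x => ?_)
        by_cases hx : x ∈ K
        · simp [hx, hg1 hx]
        · simpa [hx] using (hg x).1
    _ = μ.real Kᶜ := integral_indicator_one hKm
    _ ≤ ε / 2 := ENNReal.toReal_le_of_le_ofReal (by positivity) (hKμ μ rfl)
    _ < ε := half_lt_self hε

/-- Lemma (scmapping (i)): Let `E` be a complete, locally compact, separable metric space,
`μseq n` probability measures converging weakly to a probability measure `μ`.
If `φseq n` is a uniformly bounded sequence of measurable functions converging uniformly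
on compact sets to a continuous `φ`, then `φ` is bounded and `∫ φseq n dμseq n → ∫ φ dμ`. -/
theorem extreme_events_scmapping_i
    {E : Type*} [MetricSpace E] [CompleteSpace E] [LocallyCompactSpace E]
    [TopologicalSpace.SeparableSpace E] [MeasurableSpace E] [BorelSpace E]
    (μseq : ℕ → Measure E) (μ : Measure E)
    (hμseq : ∀ n, IsProbabilityMeasure (μseq n)) (hμ : IsProbabilityMeasure μ)
    (hweak : ∀ f : BoundedContinuousFunction E ℝ,
      Tendsto (fun n => ∫ x, f x ∂(μseq n)) atTop (𝓝 (∫ x, f x ∂μ)))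
    (φseq : ℕ → E → ℝ) (φ : E → ℝ)
    (hmeas : ∀ n, Measurable (φseq n))
    (M : ℝ) (hbdd : ∀ n x, |φseq n x| ≤ M)
    (hcont : Continuous φ)
    (hunif : ∀ C : Set E, IsCompact C → TendstoUniformlyOn φseq φ atTop C) :
    (∃ M' : ℝ, ∀ x, |φ x| ≤ M') ∧
      Tendsto (fun n => ∫ x, φseq n x ∂(μseq n)) atTop (𝓝 (∫ x, φ x ∂μ)) := by
  have hφ : ∀ x, |φ x| ≤ M := fun x =>
    le_of_tendsto ((hunif {x} isCompact_singleton).tendsto_at rfl).abs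
      (.of_forall fun n => hbdd n x)
  refine ⟨⟨M, hφ⟩, ?_⟩
  obtain ⟨x₀⟩ : Nonempty E := μ.nonempty_of_neZero
  have hM : 0 ≤ M := (abs_nonneg _).trans (hφ x₀)
  have hφint : ∀ n, Integrable φ (μseq n) := fun n =>
    .of_bound hcont.aestronglyMeasurable M (.of_forall hφ)
  have hφseqint : ∀ n, Integrable (φseq n) (μseq n) := fun n =>
    .of_bound (hmeas n).aestronglyMeasurable M (.of_forall (hbdd n))
  have hlim : Tendsto (fun n => ∫ x, φ x ∂(μseq n)) atTop (𝓝 (∫ x, φ x ∂μ)) :=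
    hweak (.ofNormedAddCommGroup φ hcont M hφ)
  suffices hdiff : Tendsto (fun n => ∫ x, (φseq n x - φ x) ∂(μseq n)) atTop (𝓝 0) by
    refine (by simpa using hdiff.add hlim : Tendsto _ atTop (𝓝 (∫ x, φ x ∂μ))).congr fun n => ?_
    rw [integral_sub (hφseqint n) (hφint n), sub_add_cancel]
  rw [Metric.tendsto_nhds]
  intro ε hε
  have hδ : 0 < ε / (2 * (2 * M + 1)) := by positivity
  obtain ⟨g, hgc, hg, hgμ⟩ := exists_hasCompactSupport_integral_one_sub_lt μ hδ
  have hgbound : ∀ x, ‖1 - g x‖ ≤ 1 := fun x => by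
    rw [Real.norm_of_nonneg (sub_nonneg.2 (hg x).2)]
    linarith [(hg x).1]
  have hgcont : Continuous fun x => 1 - g x := continuous_const.sub g.continuous
  have hglim : Tendsto (fun n => ∫ x, (1 - g x) ∂(μseq n)) atTop (𝓝 (∫ x, (1 - g x) ∂μ)) :=
    hweak (.ofNormedAddCommGroup _ hgcont 1 hgbound)
  filter_upwards [hglim.eventually_lt_const hgμ,
    Metric.tendstoUniformlyOn_iff.1 (hunif _ hgc.isCompact) (ε / 2) (half_pos hε)] with n hn hun
  have hgint : Integrable (fun x => 1 - g x) (μseq n) :=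
    .of_bound hgcont.aestronglyMeasurable 1 (.of_forall hgbound)
  have hpt : ∀ x, ‖φseq n x - φ x‖ ≤ ε / 2 + 2 * M * (1 - g x) := fun x => by
    rw [Real.norm_eq_abs]
    have h2M : |φseq n x - φ x| ≤ 2 * M := by linarith [abs_sub (φseq n x) (φ x), hbdd n x, hφ x]
    by_cases hx : x ∈ tsupport g
    · have hclose := hun x hx
      rw [dist_comm, Real.dist_eq] at hclose
      have := mul_nonneg (mul_nonneg zero_le_two hM) (sub_nonneg.2 (hg x).2)
      linarith
    · rw [image_eq_zero_of_notMem_tsupport hx]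
      linarith
  rw [dist_zero_right]
  calc ‖∫ x, (φseq n x - φ x) ∂(μseq n)‖
      ≤ ∫ x, (ε / 2 + 2 * M * (1 - g x)) ∂(μseq n) :=
        norm_integral_le_of_norm_le ((integrable_const _).add (hgint.const_mul _))
          (.of_forall hpt)
    _ = ε / 2 + 2 * M * ∫ x, (1 - g x) ∂(μseq n) := by
        rw [integral_add (integrable_const _) (hgint.const_mul _), integral_const_mul]
        simp
    _ ≤ ε / 2 + 2 * M * (ε / (2 * (2 * M + 1))) := by gcongr
    _ < ε / 2 + (2 * M + 1) * (ε / (2 * (2 * M + 1))) := by gcongr; linarith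
    _ = ε := by field_simp; ring
end

section
/- Let (E,d) be a complete, locally compact, separable metric space, let μ_n be a sequence of probability measures on E converging weakly to a probability measure μ, and let F be a topological space. If φ : F × E → ℝ is bounded and continuous, then the sequence of functions F ∋ x ↦ ∫_E φ(x,y) μ_n(dy) converges uniformly on compact sets of F to the (necessarily continuous) function F ∋ x ↦ ∫_E φ(x,y) μ(dy). -/
open MeasureTheory Filter Topology

/-- A finite Borel measure on a Polish locally compact metric space assigns arbitrarily small
integral to some nonnegative bounded continuous function equal to one off a compact set. -/
lemma exists_boundedContinuous_eq_one_off_isCompact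
    {E : Type*} [MetricSpace E] [CompleteSpace E] [LocallyCompactSpace E]
    [TopologicalSpace.SeparableSpace E] [MeasurableSpace E] [BorelSpace E]
    (μ : Measure E) [IsFiniteMeasure μ] {ε : ℝ} (hε : 0 < ε) :
    ∃ h : BoundedContinuousFunction E ℝ, ∃ K : Set E, IsCompact K ∧ (∀ y, 0 ≤ h y) ∧
      (∀ y ∉ K, h y = 1) ∧ ∫ y, h y ∂μ ≤ ε := by
  have : SecondCountableTopology E := UniformSpace.secondCountable_of_separable E
  obtain ⟨K, hK, hμK⟩ := isTightMeasureSet_iff_exists_isCompact_measure_compl_le.1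
    (isTightMeasureSet_singleton (μ := μ)) (ENNReal.ofReal ε) (by simpa)
  obtain ⟨g, hgK, -, hgc, hg⟩ :=
    exists_continuous_one_zero_of_isCompact hK isClosed_empty (Set.disjoint_empty K)
  let h : BoundedContinuousFunction E ℝ :=
    .ofNormedAddCommGroup (fun y => 1 - g y) (by fun_prop) 1 fun y => by
      rw [Real.norm_eq_abs, abs_le]
      constructor <;> linarith [(hg y).1, (hg y).2]
  have hh : ∀ y, h y = 1 - g y := fun _ => rfl
  refine ⟨h, tsupport g, hgc, fun y => by linarith [hh y, (hg y).2],
    fun y hy => by simp [hh, image_eq_zero_of_notMem_tsupport hy], ?_⟩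
  have hle : ∀ y, h y ≤ Kᶜ.indicator 1 y := fun y => by
    by_cases hy : y ∈ K
    · simp [hh, hy, hgK hy]
    · simpa [hh, hy] using (hg y).1
  calc ∫ y, h y ∂μ ≤ ∫ y, Kᶜ.indicator 1 y ∂μ :=
        integral_mono (h.integrable μ)
          ((integrable_indicator_iff hK.measurableSet.compl).2 (integrable_const 1).integrableOn)
          hle
    _ = μ.real Kᶜ := integral_indicator_one hK.measurableSet.compl
    _ ≤ ε := ENNReal.toReal_le_of_le_ofReal hε.le (hμK μ rfl)

/-- Two functions bounded by `M` and `δ`-close on `K` have close integrals, with an error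
controlled by any nonnegative function equal to one off `K`. -/
lemma abs_integral_sub_le_of_close_on
    {E : Type*} [MeasurableSpace E] {ν : Measure E} [IsProbabilityMeasure ν] {f g h : E → ℝ}
    {K : Set E} {δ M : ℝ} (hf : Integrable f ν) (hg : Integrable g ν) (hh : Integrable h ν)
    (hδ : 0 ≤ δ) (hfM : ∀ y, |f y| ≤ M) (hgM : ∀ y, |g y| ≤ M) (h0 : ∀ y, 0 ≤ h y)
    (h1 : ∀ y ∉ K, h y = 1) (hK : ∀ y ∈ K, |f y - g y| ≤ δ) :
    |∫ y, f y ∂ν - ∫ y, g y ∂ν| ≤ δ + 2 * M * ∫ y, h y ∂ν := by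
  have hbound : ∀ y, |f y - g y| ≤ δ + 2 * M * h y := fun y => by
    have hM : 0 ≤ M := (abs_nonneg _).trans (hfM y)
    by_cases hy : y ∈ K
    · have := mul_nonneg hM (h0 y)
      linarith [hK y hy]
    · rw [h1 y hy]
      linarith [abs_sub (f y) (g y), hfM y, hgM y]
  calc |∫ y, f y ∂ν - ∫ y, g y ∂ν| = |∫ y, f y - g y ∂ν| := by rw [integral_sub hf hg]
    _ ≤ ∫ y, |f y - g y| ∂ν := abs_integral_le_integral_abs
    _ ≤ ∫ y, δ + 2 * M * h y ∂ν :=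
      integral_mono (hf.sub hg).abs ((integrable_const δ).add (hh.const_mul _)) hbound
    _ = δ + 2 * M * ∫ y, h y ∂ν := by
      rw [integral_add (integrable_const δ) (hh.const_mul _), integral_const_mul]
      simp

/-- Lemma (scmapping (ii)): Let `E` be a complete, locally compact, separable metric space,
`μseq n` probability measures converging weakly to a probability measure `μ`, and `F` a
topological space. If `φ : F × E → ℝ` is bounded and continuous, then
`x ↦ ∫ φ(x,y) dμseq n (y)` converges uniformly on compact sets of `F` to the (necessarily
continuous) function `x ↦ ∫ φ(x,y) dμ(y)`. -/
theorem extreme_events_scmapping_ii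
    {E : Type*} [MetricSpace E] [CompleteSpace E] [LocallyCompactSpace E]
    [TopologicalSpace.SeparableSpace E] [MeasurableSpace E] [BorelSpace E]
    {F : Type*} [TopologicalSpace F]
    (μseq : ℕ → Measure E) (μ : Measure E)
    (hμseq : ∀ n, IsProbabilityMeasure (μseq n)) (hμ : IsProbabilityMeasure μ)
    (hweak : ∀ f : BoundedContinuousFunction E ℝ,
      Tendsto (fun n => ∫ x, f x ∂(μseq n)) atTop (𝓝 (∫ x, f x ∂μ)))
    (φ : F × E → ℝ) (hφcont : Continuous φ) (M : ℝ) (hφbdd : ∀ p, |φ p| ≤ M) :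
    Continuous (fun x : F => ∫ y, φ (x, y) ∂μ) ∧
      ∀ C : Set F, IsCompact C →
        TendstoUniformlyOn (fun n x => ∫ y, φ (x, y) ∂(μseq n))
          (fun x => ∫ y, φ (x, y) ∂μ) atTop C := by
  obtain ⟨y₀⟩ : Nonempty E := μ.nonempty_of_neZero
  let Φ : F → BoundedContinuousFunction E ℝ := fun x =>
    .ofNormedAddCommGroup (fun y => φ (x, y)) (by fun_prop) M fun y => hφbdd (x, y)
  have hint : ∀ (ν : Measure E) [IsProbabilityMeasure ν] (x : F),
      Integrable (fun y => φ (x, y)) ν := fun ν _ x => (Φ x).integrable ν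
  have key : ∀ (x₀ : F) (ε : ℝ), 0 < ε → ∃ U ∈ 𝓝 x₀,
      (∀ x ∈ U, |∫ y, φ (x, y) ∂μ - ∫ y, φ (x₀, y) ∂μ| < ε) ∧
      ∀ᶠ n in atTop, ∀ x ∈ U,
        |∫ y, φ (x, y) ∂(μseq n) - ∫ y, φ (x₀, y) ∂(μseq n)| < ε := by
    intro x₀ ε hε
    have hM : 0 ≤ M := (abs_nonneg _).trans (hφbdd (x₀, y₀))
    obtain ⟨η, hη, hηε⟩ : ∃ η > 0, ε / 2 + 2 * M * η < ε := by
      refine ⟨ε / (4 * (M + 1)), by positivity, ?_⟩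
      have : 2 * M * (ε / (4 * (M + 1))) = ε / 2 * (M / (M + 1)) := by field_simp; ring
      have : M / (M + 1) < 1 := (div_lt_one (by positivity)).2 (by linarith)
      nlinarith
    obtain ⟨h, K, hK, h0, h1, hhμ⟩ :=
      exists_boundedContinuous_eq_one_off_isCompact μ (half_pos hη)
    have hclose : ∀ᶠ x in 𝓝 x₀, ∀ y ∈ K, |φ (x, y) - φ (x₀, y)| < ε / 2 := by
      refine hK.eventually_forall_of_forall_eventually fun y _ => ?_
      have hc : Continuous fun z : F × E => |φ (z.1, z.2) - φ (x₀, z.2)| := by fun_prop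
      exact hc.continuousAt.eventually_lt continuousAt_const (by simpa using half_pos hε)
    have hdiff : ∀ (ν : Measure E) [IsProbabilityMeasure ν], ∫ y, h y ∂ν < η →
        ∀ x, (∀ y ∈ K, |φ (x, y) - φ (x₀, y)| < ε / 2) →
          |∫ y, φ (x, y) ∂ν - ∫ y, φ (x₀, y) ∂ν| < ε := by
      intro ν _ hν x hx
      have := abs_integral_sub_le_of_close_on (hint ν x) (hint ν x₀) (h.integrable ν)
        (half_pos hε).le (fun y => hφbdd _) (fun y => hφbdd _) h0 h1 fun y hy => (hx y hy).le
      have := mul_le_mul_of_nonneg_left hν.le (by positivity : 0 ≤ 2 * M)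
      linarith
    refine ⟨_, hclose, hdiff μ (hhμ.trans_lt (half_lt_self hη)), ?_⟩
    filter_upwards [(hweak h).eventually_lt_const (hhμ.trans_lt (half_lt_self hη))] with n hn
    exact hdiff (μseq n) hn
  refine ⟨continuous_iff_continuousAt.2 fun x₀ => Metric.tendsto_nhds.2 fun ε hε => ?_,
    fun C hC => ?_⟩
  · obtain ⟨U, hU, hUμ, -⟩ := key x₀ ε hε
    exact mem_of_superset hU hUμ
  · rw [← tendstoLocallyUniformlyOn_iff_tendstoUniformlyOn_of_compact hC,
      Metric.tendstoLocallyUniformlyOn_iff]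
    intro ε hε x₀ _
    obtain ⟨U, hU, hUμ, hUn⟩ := key x₀ (ε / 3) (by positivity)
    refine ⟨U, mem_nhdsWithin_of_mem_nhds hU, ?_⟩
    filter_upwards [hUn, Metric.tendsto_nhds.1 (hweak (Φ x₀)) (ε / 3) (by positivity)]
      with n hn hn₀ x hx
    have h₁ := abs_lt.1 (hUμ x hx)
    have h₂ := abs_lt.1 (hn x hx)
    have h₃ : |∫ y, φ (x₀, y) ∂(μseq n) - ∫ y, φ (x₀, y) ∂μ| < ε / 3 := hn₀
    have h₃ := abs_lt.1 h₃
    rw [Real.dist_eq, abs_lt]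
    constructor <;> linarith [h₁.1, h₁.2, h₂.1, h₂.2, h₃.1, h₃.2]
end

section
/- Let ρ ∈ (0,1), let Φ be the standard normal distribution function, let π_G(x,y) = Φ((y−ρx)/(1−ρ²)^{1/2}) be the Gaussian transition kernel, and let π(x,y) = π_G(Φ^{←}(1−e^{−x}), Φ^{←}(1−e^{−y})) be the corresponding transition kernel in standard exponential margins. Then, with norming functions a(v) = ρ²v and b(v) = v^{1/2}, the normalized kernel π(v, a(v)+b(v)·dx) converges weakly, as v ↑ ∞, to the distribution K with K(x) = Φ(x/(2ρ²(1−ρ²))^{1/2}); equivalently, for every x ∈ ℝ, lim_{v→∞} π(v, ρ²v + v^{1/2}x) = Φ(x/(2ρ²(1−ρ²))^{1/2}). -/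
open MeasureTheory Filter Topology

/-- The standard normal distribution function `Φ`. -/
noncomputable def stdNormalCDF (x : ℝ) : ℝ :=
  ∫ t in Set.Iic x, Real.exp (-t ^ 2 / 2) / Real.sqrt (2 * Real.pi)

/-- The (generalized) inverse `Φ^{←}` of the standard normal distribution function. -/
noncomputable def stdNormalInv (p : ℝ) : ℝ :=
  sInf {x : ℝ | p ≤ stdNormalCDF x}

/-- The Gaussian transition kernel `π_G(x,y) = Φ((y - ρx)/(1-ρ²)^{1/2})`. -/
noncomputable def gaussKernelCDF (ρ : ℝ) (x y : ℝ) : ℝ :=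
  stdNormalCDF ((y - ρ * x) / Real.sqrt (1 - ρ ^ 2))

/-- The Gaussian transition kernel transformed to standard exponential margins. -/
noncomputable def gaussExpKernelCDF (ρ : ℝ) (x y : ℝ) : ℝ :=
  gaussKernelCDF ρ (stdNormalInv (1 - Real.exp (-x))) (stdNormalInv (1 - Real.exp (-y)))

open ProbabilityTheory (gaussianPDFReal integrable_gaussianPDFReal
  integral_gaussianPDFReal_eq_one)

/-- The standard normal density. -/
noncomputable def stdNormalPDF (t : ℝ) : ℝ :=
  Real.exp (-t ^ 2 / 2) / Real.sqrt (2 * Real.pi)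

lemma stdNormalPDF_eq_gaussianPDFReal : stdNormalPDF = gaussianPDFReal 0 1 := by
  ext t
  simp [stdNormalPDF, gaussianPDFReal, div_eq_inv_mul]

lemma stdNormalPDF_nonneg (t : ℝ) : 0 ≤ stdNormalPDF t := by
  unfold stdNormalPDF; positivity

lemma continuous_stdNormalPDF : Continuous stdNormalPDF := by
  unfold stdNormalPDF; fun_prop

lemma integrable_stdNormalPDF : Integrable stdNormalPDF := by
  rw [stdNormalPDF_eq_gaussianPDFReal]
  exact integrable_gaussianPDFReal 0 1

lemma integral_stdNormalPDF : ∫ t, stdNormalPDF t = 1 := by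
  rw [stdNormalPDF_eq_gaussianPDFReal]
  exact integral_gaussianPDFReal_eq_one 0 one_ne_zero

lemma stdNormalCDF_eq (x : ℝ) : stdNormalCDF x = ∫ t in Set.Iic x, stdNormalPDF t := rfl

lemma stdNormalCDF_sub_eq_intervalIntegral (x y : ℝ) :
    stdNormalCDF y - stdNormalCDF x = ∫ t in x..y, stdNormalPDF t :=
  intervalIntegral.integral_Iic_sub_Iic integrable_stdNormalPDF.integrableOn
    integrable_stdNormalPDF.integrableOn

lemma continuous_stdNormalCDF : Continuous stdNormalCDF := by
  have h : stdNormalCDF = fun x => stdNormalCDF 0 + ∫ t in (0 : ℝ)..x, stdNormalPDF t := by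
    ext x
    rw [← stdNormalCDF_sub_eq_intervalIntegral]
    ring
  rw [h]
  exact continuous_const.add (intervalIntegral.continuous_primitive
    (fun _ _ => integrable_stdNormalPDF.intervalIntegrable) 0)

lemma monotone_stdNormalCDF : Monotone stdNormalCDF := fun x y hxy => by
  have h := intervalIntegral.integral_nonneg (μ := volume) hxy
    (fun t _ => stdNormalPDF_nonneg t)
  rw [← stdNormalCDF_sub_eq_intervalIntegral] at h
  linarith

lemma one_sub_stdNormalCDF (x : ℝ) :
    1 - stdNormalCDF x = ∫ t in Set.Ioi x, stdNormalPDF t := by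
  have h := intervalIntegral.integral_Iic_add_Ioi (b := x)
    integrable_stdNormalPDF.integrableOn integrable_stdNormalPDF.integrableOn
  rw [integral_stdNormalPDF] at h
  rw [stdNormalCDF_eq, ← h]
  ring

lemma stdNormalCDF_le_one (x : ℝ) : stdNormalCDF x ≤ 1 := by
  have h := setIntegral_nonneg (μ := volume) (measurableSet_Ioi (a := x)) fun t _ =>
    stdNormalPDF_nonneg t
  rw [← one_sub_stdNormalCDF] at h
  linarith

/-- Chernoff bound for the standard normal upper tail. -/
lemma one_sub_stdNormalCDF_le {z : ℝ} (hz : 0 ≤ z) :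
    1 - stdNormalCDF z ≤ Real.exp (-z ^ 2 / 2) := by
  have hint : Integrable (fun t => Real.exp (-z ^ 2 / 2) * stdNormalPDF (t - z)) :=
    (integrable_stdNormalPDF.comp_sub_right z).const_mul _
  calc 1 - stdNormalCDF z = ∫ t in Set.Ioi z, stdNormalPDF t := one_sub_stdNormalCDF z
    _ ≤ ∫ t in Set.Ioi z, Real.exp (-z ^ 2 / 2) * stdNormalPDF (t - z) := by
        refine setIntegral_mono_on integrable_stdNormalPDF.integrableOn hint.integrableOn
          measurableSet_Ioi fun t ht => ?_
        rw [stdNormalPDF, stdNormalPDF, mul_div_assoc', ← Real.exp_add]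
        gcongr
        nlinarith [mul_nonneg hz (sub_nonneg.2 (Set.mem_Ioi.1 ht).le)]
    _ ≤ ∫ t, Real.exp (-z ^ 2 / 2) * stdNormalPDF (t - z) :=
        setIntegral_le_integral hint
          (Eventually.of_forall fun t => mul_nonneg (Real.exp_nonneg _) (stdNormalPDF_nonneg _))
    _ = Real.exp (-z ^ 2 / 2) := by
        rw [integral_const_mul, integral_sub_right_eq_self stdNormalPDF z,
          integral_stdNormalPDF, mul_one]

lemma le_one_sub_stdNormalCDF {z δ : ℝ} (hz : 0 ≤ z) (hδ : 0 ≤ δ) :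
    δ * stdNormalPDF (z + δ) ≤ 1 - stdNormalCDF z := by
  have h : ∫ _ in z..(z + δ), stdNormalPDF (z + δ) ≤ ∫ t in z..(z + δ), stdNormalPDF t := by
    refine intervalIntegral.integral_mono_on (by linarith) (by simp)
      integrable_stdNormalPDF.intervalIntegrable fun t ht => ?_
    have ht₀ : 0 ≤ t := hz.trans ht.1
    have ht₁ : t ≤ z + δ := ht.2
    unfold stdNormalPDF
    gcongr
  rw [intervalIntegral.integral_const, ← stdNormalCDF_sub_eq_intervalIntegral, smul_eq_mul,
    add_sub_cancel_left] at h
  linarith [stdNormalCDF_le_one (z + δ)]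

lemma one_sub_exp_neg_le_stdNormalCDF {v : ℝ} (hv : 0 ≤ v) :
    1 - Real.exp (-v) ≤ stdNormalCDF (Real.sqrt (2 * v)) := by
  have h := one_sub_stdNormalCDF_le (Real.sqrt_nonneg (2 * v))
  rw [Real.sq_sqrt (by positivity), show -(2 * v) / 2 = -v by ring] at h
  linarith

lemma tendsto_sqrt_two_mul_atTop : Tendsto (fun v : ℝ => Real.sqrt (2 * v)) atTop atTop :=
  Real.tendsto_sqrt_atTop.comp (tendsto_id.const_mul_atTop two_pos)

lemma eventually_stdNormalCDF_lt {ε : ℝ} (hε : 0 < ε) :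
    ∀ᶠ v : ℝ in atTop, stdNormalCDF (Real.sqrt (2 * v) - ε) < 1 - Real.exp (-v) := by
  have hgrow : Tendsto (fun v : ℝ => Real.exp (ε / 2 * Real.sqrt (2 * v) - ε ^ 2 / 8))
      atTop atTop :=
    Real.tendsto_exp_atTop.comp (tendsto_atTop_add_const_right _ _
      (tendsto_sqrt_two_mul_atTop.const_mul_atTop (half_pos hε)))
  filter_upwards [hgrow.eventually_gt_atTop (Real.sqrt (2 * Real.pi) / (ε / 2)),
    tendsto_sqrt_two_mul_atTop.eventually_ge_atTop ε, eventually_ge_atTop 0] with v h₁ h₂ h₃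
  have h := le_one_sub_stdNormalCDF (sub_nonneg.2 h₂) (half_pos hε).le
  have hpdf : stdNormalPDF (Real.sqrt (2 * v) - ε + ε / 2) =
      Real.exp (-v) * Real.exp (ε / 2 * Real.sqrt (2 * v) - ε ^ 2 / 8) /
        Real.sqrt (2 * Real.pi) := by
    rw [stdNormalPDF, ← Real.exp_add]
    congr 2
    linear_combination (-1 / 2) * Real.sq_sqrt (by positivity : 0 ≤ 2 * v)
  have hπ : 0 < Real.sqrt (2 * Real.pi) := by positivity
  have hlt : Real.exp (-v) < ε / 2 * stdNormalPDF (Real.sqrt (2 * v) - ε + ε / 2) := by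
    rw [hpdf, mul_div_assoc', lt_div_iff₀ hπ]
    rw [div_lt_iff₀ (half_pos hε)] at h₁
    nlinarith [mul_lt_mul_of_pos_left h₁ (Real.exp_pos (-v))]
  linarith

/-- First-order asymptotics of the standard normal quantile function in exponential scale. -/
lemma tendsto_stdNormalInv_sub_sqrt :
    Tendsto (fun v : ℝ => stdNormalInv (1 - Real.exp (-v)) - Real.sqrt (2 * v)) atTop (𝓝 0) := by
  rw [Metric.tendsto_nhds]
  intro ε hε
  filter_upwards [eventually_stdNormalCDF_lt (half_pos hε), eventually_ge_atTop 0] with v h₁ h₂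
  have hmem := one_sub_exp_neg_le_stdNormalCDF h₂
  have hlb : ∀ x ∈ {x : ℝ | 1 - Real.exp (-v) ≤ stdNormalCDF x},
      Real.sqrt (2 * v) - ε / 2 ≤ x := fun x hx =>
    (monotone_stdNormalCDF.reflect_lt (h₁.trans_le hx)).le
  have hle : stdNormalInv (1 - Real.exp (-v)) ≤ Real.sqrt (2 * v) := csInf_le ⟨_, hlb⟩ hmem
  have hge : Real.sqrt (2 * v) - ε / 2 ≤ stdNormalInv (1 - Real.exp (-v)) :=
    le_csInf ⟨_, hmem⟩ hlb
  rw [Real.dist_eq, sub_zero, abs_lt]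
  constructor <;> linarith

lemma tendsto_mul_add_sqrt_mul_atTop {c : ℝ} (hc : 0 < c) (x : ℝ) :
    Tendsto (fun v : ℝ => c * v + Real.sqrt v * x) atTop atTop := by
  have h : Tendsto (fun v : ℝ => Real.sqrt v * (c * Real.sqrt v + x)) atTop atTop :=
    Real.tendsto_sqrt_atTop.atTop_mul_atTop₀
      (tendsto_atTop_add_const_right _ _ (Real.tendsto_sqrt_atTop.const_mul_atTop hc))
  refine h.congr' ?_
  filter_upwards [eventually_ge_atTop 0] with v hv
  linear_combination c * Real.mul_self_sqrt hv

lemma tendsto_sqrt_sub_mul_sqrt {ρ : ℝ} (hρ : 0 < ρ) (x : ℝ) :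
    Tendsto (fun v : ℝ => Real.sqrt (2 * (ρ ^ 2 * v + Real.sqrt v * x)) - ρ * Real.sqrt (2 * v))
      atTop (𝓝 (x / (Real.sqrt 2 * ρ))) := by
  have hs : Tendsto (fun v : ℝ => (Real.sqrt v)⁻¹) atTop (𝓝 0) :=
    tendsto_inv_atTop_zero.comp Real.tendsto_sqrt_atTop
  have hcont : Continuous fun s : ℝ => Real.sqrt (2 * (ρ ^ 2 + s * x)) := by fun_prop
  have hroot := (hcont.tendsto 0).comp hs
  have h₂ : 0 < Real.sqrt 2 := by positivity
  have h₀ : Real.sqrt (2 * (ρ ^ 2 + 0 * x)) = Real.sqrt 2 * ρ := by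
    rw [zero_mul, add_zero, Real.sqrt_mul two_pos.le, Real.sqrt_sq hρ.le]
  rw [h₀] at hroot
  have hlim := (tendsto_const_nhds (x := 2 * x)).div (hroot.add_const (Real.sqrt 2 * ρ))
    (by positivity)
  have hval : 2 * x / (Real.sqrt 2 * ρ + Real.sqrt 2 * ρ) = x / (Real.sqrt 2 * ρ) := by
    field_simp
    ring
  rw [hval] at hlim
  refine hlim.congr' ?_
  filter_upwards [eventually_gt_atTop 0,
    (tendsto_mul_add_sqrt_mul_atTop (pow_pos hρ 2) x).eventually_ge_atTop 0] with v hv hnn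
  have hsv : 0 < Real.sqrt v := Real.sqrt_pos.2 hv
  have hvv : Real.sqrt v ^ 2 = v := Real.sq_sqrt hv.le
  have hfac : ρ ^ 2 * v + Real.sqrt v * x = v * (ρ ^ 2 + (Real.sqrt v)⁻¹ * x) := by
    field_simp
    linear_combination x * hvv
  have hq : 0 ≤ ρ ^ 2 + (Real.sqrt v)⁻¹ * x := by
    rw [hfac] at hnn
    exact nonneg_of_mul_nonneg_right hnn hv
  have hsq : Real.sqrt (2 * (ρ ^ 2 + (Real.sqrt v)⁻¹ * x)) ^ 2 =
      2 * (ρ ^ 2 + (Real.sqrt v)⁻¹ * x) := Real.sq_sqrt (by positivity)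
  have h22 : Real.sqrt 2 ^ 2 = 2 := Real.sq_sqrt two_pos.le
  have hinv : Real.sqrt v * (Real.sqrt v)⁻¹ = 1 := mul_inv_cancel₀ hsv.ne'
  rw [hfac, mul_left_comm, Real.sqrt_mul hv.le, Real.sqrt_mul two_pos.le v]
  simp only [Pi.div_apply, Function.comp_apply]
  rw [div_eq_iff (by positivity)]
  linear_combination (-Real.sqrt v) * hsq + Real.sqrt v * ρ ^ 2 * h22 - 2 * x * hinv

/-- Example 1 (Gaussian transition kernel with exponential margins): for `ρ ∈ (0,1)`,
with norming functions `a(v) = ρ²v` and `b(v) = v^{1/2}`, the normalized kernel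
`π(v, a(v)+b(v)·dx)` converges weakly, as `v → ∞`, to `K(x) = Φ(x/(2ρ²(1-ρ²))^{1/2})`;
equivalently the distribution functions converge pointwise. -/
theorem extreme_events_gauss_exp_margins
    (ρ : ℝ) (hρ : ρ ∈ Set.Ioo (0 : ℝ) 1) :
    ∀ x : ℝ,
      Tendsto (fun v => gaussExpKernelCDF ρ v (ρ ^ 2 * v + Real.sqrt v * x)) atTop
        (𝓝 (stdNormalCDF (x / Real.sqrt (2 * ρ ^ 2 * (1 - ρ ^ 2))))) := by
  intro x
  obtain ⟨hρ₀, hρ₁⟩ := hρ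
  have hy := tendsto_stdNormalInv_sub_sqrt.comp
    (tendsto_mul_add_sqrt_mul_atTop (pow_pos hρ₀ 2) x)
  have hlim := ((hy.sub (tendsto_stdNormalInv_sub_sqrt.const_mul ρ)).add
    (tendsto_sqrt_sub_mul_sqrt hρ₀ x)).div_const (Real.sqrt (1 - ρ ^ 2))
  have hval : (0 - ρ * 0 + x / (Real.sqrt 2 * ρ)) / Real.sqrt (1 - ρ ^ 2) =
      x / Real.sqrt (2 * ρ ^ 2 * (1 - ρ ^ 2)) := by
    rw [Real.sqrt_mul (by positivity), Real.sqrt_mul two_pos.le, Real.sqrt_sq hρ₀.le,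
      mul_zero, sub_zero, zero_add, div_div]
  rw [hval] at hlim
  refine ((continuous_stdNormalCDF.tendsto _).comp hlim).congr fun v => ?_
  simp only [Function.comp_apply, gaussExpKernelCDF, gaussKernelCDF]
  congr 2
  ring
end

section
/- Let α ∈ (0,1), β ∈ [0,1), and consider the Heffernan–Tawn norming functions a(v) = αv, b(v) = v^β, with t-step normings a_t(v) = α^t v and b_t(v) = v^β for t ≥ 1. Then for every t ≥ 1: (i) [a(a_t(v)+b_t(v)x) − a_{t+1}(v)]/b_{t+1}(v) = αx exactly for all v, x; and (ii) b(a_t(v)+b_t(v)x)/b_{t+1}(v) = (α^t v + v^β x)^β / v^β → α^{tβ} as v ↑ ∞, uniformly on compact sets in x ∈ ℝ, with the remainder term r^b_{t+1}(v,x) = 1 − v^β α^{tβ}/(α^t v + v^β x)^β of order O(v^{β−1}). Hence assumption A2 holds with update functions ψ^a_{t+1}(x) = αx and ψ^b_{t+1}(x) = α^{tβ}, giving the scaled autoregressive tail chain M_{t+1} = αM_t + α^{tβ}ε_{t+1}. -/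
open Filter Topology

theorem abs_rpow_sub_one_le {s p : ℝ} (hs : 0 < s) (hp0 : 0 ≤ p) (hp1 : p ≤ 1) :
    |s ^ p - 1| ≤ |s - 1| := by
  rcases le_total 1 s with h | h
  · have h1 : 1 ≤ s ^ p := Real.one_le_rpow h hp0
    have h2 : s ^ p ≤ s := by
      simpa using Real.rpow_le_rpow_of_exponent_le h hp1
    rw [abs_of_nonneg (by linarith), abs_of_nonneg (by linarith)]
    linarith
  · have h1 : s ^ p ≤ 1 := Real.rpow_le_one hs.le h hp0
    have h2 : s ≤ s ^ p := by
      simpa using Real.rpow_le_rpow_of_exponent_ge hs h hp1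
    rw [abs_of_nonpos (by linarith), abs_of_nonpos (by linarith)]
    linarith

theorem abs_one_sub_inv_rpow_le {s p : ℝ} (hs : 1 / 2 ≤ s) (hp0 : 0 ≤ p) (hp1 : p ≤ 1) :
    |1 - (s ^ p)⁻¹| ≤ 2 * |s - 1| := by
  have hs0 : 0 < s := by linarith
  have h := abs_rpow_sub_one_le (inv_pos.2 hs0) hp0 hp1
  rw [Real.inv_rpow hs0.le] at h
  rw [abs_sub_comm]
  refine h.trans ?_
  have h1 : s⁻¹ - 1 = -(s⁻¹ * (s - 1)) := by field_simp; ring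
  have h2 : s⁻¹ ≤ 2 := by
    rw [inv_le_comm₀ hs0 two_pos]
    linarith
  rw [h1, abs_neg, abs_mul, abs_of_pos (inv_pos.2 hs0)]
  gcongr

theorem tendsto_rpow_sub_one_atTop {β : ℝ} (hβ : β < 1) :
    Tendsto (fun v : ℝ => v ^ (β - 1)) atTop (𝓝 0) := by
  simpa using tendsto_rpow_neg_atTop (sub_pos.2 hβ)

/-- On a bounded range of `x`, the perturbation `v ^ β * x` changes `A * v` by a factor
`1 + O(v ^ (β - 1))`. -/
theorem exists_eventually_factor {A β : ℝ} (hA : 0 < A) (hβ : β < 1) {C : Set ℝ}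
    (hC : IsCompact C) :
    ∃ c : ℝ, 0 < c ∧ ∀ᶠ v : ℝ in atTop, 0 < v ∧ ∀ x ∈ C, ∃ s : ℝ, 1 / 2 ≤ s ∧
      |s - 1| ≤ c * v ^ (β - 1) ∧ A * v + v ^ β * x = A * v * s := by
  obtain ⟨K, hK, hCK⟩ := hC.isBounded.exists_pos_norm_le
  have hc : 0 < K / A := div_pos hK hA
  have hlim : Tendsto (fun v : ℝ => K / A * v ^ (β - 1)) atTop (𝓝 0) := by
    simpa using (tendsto_rpow_sub_one_atTop hβ).const_mul (K / A)
  refine ⟨K / A, hc, ?_⟩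
  filter_upwards [eventually_gt_atTop 0, hlim.eventually_lt_const (one_half_pos (α := ℝ))]
    with v hv hsmall
  refine ⟨hv, fun x hx => ⟨1 + x / A * v ^ (β - 1), ?_⟩⟩
  have hbound : |x / A * v ^ (β - 1)| ≤ K / A * v ^ (β - 1) := by
    rw [abs_mul, abs_div, abs_of_pos hA, abs_of_pos (Real.rpow_pos_of_pos hv _)]
    have := hCK x hx
    rw [Real.norm_eq_abs] at this
    gcongr
  refine ⟨?_, by simpa using hbound, ?_⟩
  · linarith [neg_abs_le (x / A * v ^ (β - 1))]
  · rw [Real.rpow_sub_one hv.ne']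
    field_simp

/-- Example 2 (ii) (Heffernan–Tawn normalization, `α ∈ (0,1)`, `β ∈ [0,1)`): with
`a(v) = αv`, `b(v) = v^β`, `a_t(v) = α^t v`, `b_t(v) = v^β`, for every `t ≥ 1`:
(i) `[a(a_t(v)+b_t(v)x) - a_{t+1}(v)]/b_{t+1}(v) = αx` exactly (for `v > 0`);
(ii) `b(a_t(v)+b_t(v)x)/b_{t+1}(v) = (α^t v + v^β x)^β / v^β → α^{tβ}` uniformly on
compact sets in `x`, with remainder `r^b_{t+1}(v,x) = 1 - v^β α^{tβ}/(α^t v + v^β x)^β`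
of order `O(v^{β-1})`. These are the update functions `ψ^a_{t+1}(x) = αx` and
`ψ^b_{t+1}(x) = α^{tβ}` of assumption A2, giving the scaled autoregressive tail chain
`M_{t+1} = αM_t + α^{tβ} ε_{t+1}`. -/
theorem extreme_events_heffernan_tawn_norming
    (α β : ℝ) (hα : α ∈ Set.Ioo (0 : ℝ) 1) (hβ : β ∈ Set.Ico (0 : ℝ) 1) :
    ∀ t : ℕ, 1 ≤ t →
      -- (i) the location update is exact: `ψ^a_{t+1}(x) = αx`
      (∀ v : ℝ, 0 < v → ∀ x : ℝ,
        (α * (α ^ t * v + v ^ β * x) - α ^ (t + 1) * v) / v ^ β = α * x) ∧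
      -- (ii) the scale ratio converges to `ψ^b_{t+1}(x) = α^{tβ}` uniformly on compacts
      (∀ C : Set ℝ, IsCompact C →
        TendstoUniformlyOn
          (fun v x => (α ^ t * v + v ^ β * x) ^ β / v ^ β)
          (fun _ => α ^ ((t : ℝ) * β)) atTop C) ∧
      -- the remainder term `r^b_{t+1}(v,x)` is of order `O(v^{β-1})`, uniformly on compacts
      (∀ C : Set ℝ, IsCompact C → ∃ c : ℝ, 0 < c ∧ ∃ V : ℝ, ∀ v : ℝ, V ≤ v → ∀ x ∈ C,
        |1 - v ^ β * α ^ ((t : ℝ) * β) / (α ^ t * v + v ^ β * x) ^ β| ≤ c * v ^ (β - 1)) := by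
  obtain ⟨hα0, -⟩ := hα
  obtain ⟨hβ0, hβ1⟩ := hβ
  intro t _
  have hA : 0 < α ^ t := pow_pos hα0 t
  have hpow : α ^ ((t : ℝ) * β) = (α ^ t) ^ β := by
    rw [Real.rpow_mul hα0.le, Real.rpow_natCast]
  have hAβ : 0 < (α ^ t) ^ β := Real.rpow_pos_of_pos hA β
  refine ⟨fun v hv x => ?_, fun C hC => ?_, fun C hC => ?_⟩
  · have : v ^ β ≠ 0 := (Real.rpow_pos_of_pos hv β).ne'
    field_simp
    ring
  · obtain ⟨c, -, hfac⟩ := exists_eventually_factor hA hβ1 hC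
    have hlim : Tendsto (fun v : ℝ => (α ^ t) ^ β * (c * v ^ (β - 1))) atTop (𝓝 0) := by
      simpa using ((tendsto_rpow_sub_one_atTop hβ1).const_mul c).const_mul ((α ^ t) ^ β)
    rw [Metric.tendstoUniformlyOn_iff]
    intro ε hε
    filter_upwards [hfac, hlim.eventually_lt_const hε] with v ⟨hv, hs⟩ hsmall x hx
    obtain ⟨s, hs2, hs1, heq⟩ := hs x hx
    have hs0 : 0 < s := by linarith
    have hvβ : v ^ β ≠ 0 := (Real.rpow_pos_of_pos hv β).ne'
    have hdiff : (α ^ t * v + v ^ β * x) ^ β / v ^ β - (α ^ t) ^ β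
        = (α ^ t) ^ β * (s ^ β - 1) := by
      rw [heq, Real.mul_rpow (by positivity) hs0.le, Real.mul_rpow hA.le hv.le]
      field_simp
    rw [dist_comm, Real.dist_eq, hpow, hdiff, abs_mul, abs_of_pos hAβ]
    refine lt_of_le_of_lt ?_ hsmall
    gcongr
    exact (abs_rpow_sub_one_le hs0 hβ0 hβ1.le).trans hs1
  · obtain ⟨c, hc, hfac⟩ := exists_eventually_factor hA hβ1 hC
    obtain ⟨V, hV⟩ := eventually_atTop.1 hfac
    refine ⟨2 * c, by positivity, V, fun v hvV x hx => ?_⟩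
    obtain ⟨hv, hs⟩ := hV v hvV
    obtain ⟨s, hs2, hs1, heq⟩ := hs x hx
    have hs0 : 0 < s := by linarith
    have hvβ : v ^ β ≠ 0 := (Real.rpow_pos_of_pos hv β).ne'
    have hratio : v ^ β * (α ^ t) ^ β / (α ^ t * v + v ^ β * x) ^ β = (s ^ β)⁻¹ := by
      have := (Real.rpow_pos_of_pos hs0 β).ne'
      rw [heq, Real.mul_rpow (by positivity) hs0.le, Real.mul_rpow hA.le hv.le]
      field_simp
    rw [hpow, hratio]
    linarith [abs_one_sub_inv_rpow_le hs2 hβ0 hβ1.le]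
end

section
/- Let κ, γ > 0, δ ∈ ℝ, c = δ + 2(1+γ), ζ_t = C(t,t−2) + C(t,t−1)c for t ≥ 2 (binomial coefficients), ζ_1 = c, and define a_t(v) = v (log v / κ)^{−t/γ} (1 + (ζ_t/γ²)(log log v)/(log v)) and b_t(v) = a_t(v)/log v for t ≥ 1, with a = a_1, b = b_1. Then for every t ≥ 1, as v ↑ ∞: (i) [a(a_t(v)+b_t(v)x) − a_{t+1}(v)]/b_{t+1}(v) → x − (t/γ²) log κ, with remainder of order O((log log v)²/log v); and (ii) b(a_t(v)+b_t(v)x)/b_{t+1}(v) → 1, with remainder of order O(log log v / log v); both convergences holding uniformly on compact sets in x ∈ ℝ. Hence the update functions are ψ^a_{t+1}(x) = x − (t/γ²) log κ and ψ^b_{t+1}(x) = 1, giving the random walk tail chain with drift M_{t+1} = M_t − (t/γ²) log κ + ε_{t+1}. -/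
open Filter Topology

/-- The coefficients `ζ_t`: `ζ_1 = c` and `ζ_t = C(t,t-2) + C(t,t-1)·c` for `t ≥ 2`. -/
noncomputable def zetaHT (c : ℝ) (t : ℕ) : ℝ :=
  if t = 1 then c else (t.choose (t - 2) : ℝ) + (t.choose (t - 1) : ℝ) * c

/-- The `t`-step location norming
`a_t(v) = v (log v / κ)^{-t/γ} (1 + (ζ_t/γ²)(log log v)/(log v))`. -/
noncomputable def aIMS (κ γ c : ℝ) (t : ℕ) (v : ℝ) : ℝ :=
  v * (Real.log v / κ) ^ (-(t : ℝ) / γ)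
    * (1 + zetaHT c t / γ ^ 2 * (Real.log (Real.log v) / Real.log v))

/-- The `t`-step scale norming `b_t(v) = a_t(v)/log v`. -/
noncomputable def bIMS (κ γ c : ℝ) (t : ℕ) (v : ℝ) : ℝ :=
  aIMS κ γ c t v / Real.log v

/-- `HasFirstOrderExpansion l ε A α` says that `A = 1 + α + O(ε²)` along `l`, with `α = O(ε)`. -/
def HasFirstOrderExpansion {X : Type*} (l : Filter X) (ε A α : X → ℝ) : Prop :=
  (fun p => A p - 1 - α p) =O[l] (fun p => ε p ^ 2) ∧ α =O[l] ε

theorem Real.log_one_add_sub_self_isBigO :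
    (fun y : ℝ => Real.log (1 + y) - y) =O[𝓝 0] (fun y => y ^ 2) := by
  refine Asymptotics.IsBigO.of_bound 2 ?_
  filter_upwards [Metric.ball_mem_nhds (0 : ℝ) (by norm_num : (0 : ℝ) < 1 / 2)] with y hy
  rw [mem_ball_zero_iff, Real.norm_eq_abs] at hy
  have h := Real.abs_log_sub_add_sum_range_le (x := -y) (by rw [abs_neg]; linarith) 1
  simp only [Finset.range_one, Finset.sum_singleton, abs_neg] at h
  norm_num at h
  rw [Real.norm_eq_abs, Real.norm_eq_abs, abs_of_nonneg (sq_nonneg y), sub_eq_neg_add]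
  refine h.trans ?_
  rw [div_le_iff₀ (by linarith)]
  nlinarith [sq_nonneg y]

theorem Real.exp_sub_one_sub_self_isBigO :
    (fun z : ℝ => Real.exp z - 1 - z) =O[𝓝 0] (fun z => z ^ 2) := by
  have h := Real.exp_sub_sum_range_isBigO_pow 2
  simpa [Finset.sum_range_succ, sub_sub] using h

namespace HasFirstOrderExpansion

variable {X : Type*} {l : Filter X} {ε A B α β : X → ℝ}

theorem sq_isBigO (hε : Tendsto ε l (𝓝 0)) : (fun p => ε p ^ 2) =O[l] ε := by
  simpa [sq] using (hε.isBigO_one ℝ).mul (Asymptotics.isBigO_refl ε l)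

theorem one_add (hα : α =O[l] ε) : HasFirstOrderExpansion l ε (fun p => 1 + α p) α :=
  ⟨by simpa using Asymptotics.isBigO_zero _ _, hα⟩

theorem sub_one_isBigO (h : HasFirstOrderExpansion l ε A α) (hε : Tendsto ε l (𝓝 0)) :
    (fun p => A p - 1) =O[l] ε := by
  simpa using (h.1.trans (sq_isBigO hε)).add h.2

theorem tendsto_one (h : HasFirstOrderExpansion l ε A α) (hε : Tendsto ε l (𝓝 0)) :
    Tendsto A l (𝓝 1) := by
  simpa using ((h.sub_one_isBigO hε).trans_tendsto hε).add_const 1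

theorem mul (hA : HasFirstOrderExpansion l ε A α) (hB : HasFirstOrderExpansion l ε B β)
    (hε : Tendsto ε l (𝓝 0)) :
    HasFirstOrderExpansion l ε (fun p => A p * B p) (fun p => α p + β p) := by
  refine ⟨?_, hA.2.add hB.2⟩
  have h := (hA.sub_one_isBigO hε).mul (hB.sub_one_isBigO hε)
  simp only [← sq] at h
  refine ((h.add hA.1).add hB.1).congr_left fun p => ?_
  ring

theorem log_sub_isBigO (hA : HasFirstOrderExpansion l ε A α) (hε : Tendsto ε l (𝓝 0)) :
    (fun p => Real.log (A p) - α p) =O[l] (fun p => ε p ^ 2) := by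
  have h1 := hA.sub_one_isBigO hε
  have h := (Real.log_one_add_sub_self_isBigO.comp_tendsto (h1.trans_tendsto hε)).trans
    (h1.pow 2)
  refine (h.add hA.1).congr_left fun p => ?_
  simp

theorem log_isBigO (hA : HasFirstOrderExpansion l ε A α) (hε : Tendsto ε l (𝓝 0)) :
    (fun p => Real.log (A p)) =O[l] ε := by
  simpa using ((hA.log_sub_isBigO hε).trans (sq_isBigO hε)).add hA.2

theorem exp (hB : (fun p => B p - β p) =O[l] (fun p => ε p ^ 2)) (hβ : β =O[l] ε)
    (hε : Tendsto ε l (𝓝 0)) : HasFirstOrderExpansion l ε (fun p => Real.exp (B p)) β := by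
  refine ⟨?_, hβ⟩
  have h1 : B =O[l] ε := by simpa using (hB.trans (sq_isBigO hε)).add hβ
  have h := (Real.exp_sub_one_sub_self_isBigO.comp_tendsto (h1.trans_tendsto hε)).trans
    (h1.pow 2)
  refine (h.add hB).congr_left fun p => ?_
  simp

theorem rpow (hA : HasFirstOrderExpansion l ε A α) (hε : Tendsto ε l (𝓝 0)) (r : ℝ) :
    HasFirstOrderExpansion l ε (fun p => A p ^ r) (fun p => r * α p) := by
  have h := exp (B := fun p => r * Real.log (A p)) (β := fun p => r * α p)
    (((hA.log_sub_isBigO hε).const_mul_left r).congr_left fun p => by ring)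
    (hA.2.const_mul_left r) hε
  refine ⟨h.1.congr' ?_ EventuallyEq.rfl, h.2⟩
  filter_upwards [(hA.tendsto_one hε).eventually (lt_mem_nhds one_pos)] with p hp
  rw [Real.rpow_def_of_pos hp, mul_comm r]

theorem inv (hA : HasFirstOrderExpansion l ε A α) (hε : Tendsto ε l (𝓝 0)) :
    HasFirstOrderExpansion l ε (fun p => (A p)⁻¹) (fun p => -α p) := by
  simpa [Real.rpow_neg_one] using hA.rpow hε (-1)

end HasFirstOrderExpansion

theorem zetaHT_succ (c : ℝ) {t : ℕ} (ht : 1 ≤ t) :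
    zetaHT c (t + 1) = zetaHT c t + t + c := by
  obtain rfl | ht2 := ht.eq_or_lt
  · norm_num [zetaHT]; ring
  · obtain ⟨s, rfl⟩ := Nat.exists_eq_add_of_le' ht2
    have h1 : (s + 2 + 1).choose (s + 1) = (s + 2).choose s + (s + 2).choose (s + 1) :=
      Nat.choose_succ_succ _ _
    have h2 : (s + 2).choose (s + 1) = s + 2 := Nat.choose_succ_self_right (s + 1)
    have h3 : (s + 2 + 1).choose (s + 2) = s + 3 := Nat.choose_succ_self_right (s + 2)
    simp only [zetaHT, show s + 2 + 1 - 2 = s + 1 by omega,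
      show s + 2 - 2 = s by omega, show s + 2 + 1 - 1 = s + 2 by omega,
      show s + 2 - 1 = s + 1 by omega, show s + 2 ≠ 1 by omega,
      show s + 2 + 1 ≠ 1 by omega, if_false, h1, h2, h3]
    push_cast
    ring

section Uniform

variable {C : Set ℝ} {F : ℝ → ℝ → ℝ} {f g : ℝ → ℝ}

theorem tendstoUniformlyOn_of_isBigO
    (h : (fun p : ℝ × ℝ => F p.1 p.2 - f p.2) =O[atTop ×ˢ 𝓟 C] (fun p => g p.1))
    (hg : Tendsto g atTop (𝓝 0)) : TendstoUniformlyOn F f atTop C := by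
  have h0 := h.trans_tendsto (hg.comp tendsto_fst)
  rw [Metric.tendstoUniformlyOn_iff]
  intro e he
  have := (Metric.tendsto_nhds.1 h0) e he
  rw [eventually_prod_principal_iff] at this
  filter_upwards [this] with v hv x hx
  simpa [dist_comm, Real.dist_eq] using hv x hx

theorem exists_uniform_bound_of_isBigO
    (h : (fun p : ℝ × ℝ => F p.1 p.2 - f p.2) =O[atTop ×ˢ 𝓟 C] (fun p => g p.1))
    (hg : ∀ᶠ v in atTop, 0 ≤ g v) :
    ∃ c' : ℝ, 0 < c' ∧ ∃ V : ℝ, ∀ v : ℝ, V ≤ v → ∀ x ∈ C, |F v x - f x| ≤ c' * g v := by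
  obtain ⟨c', hc', hb⟩ := h.exists_pos
  have hb := hb.bound
  rw [eventually_prod_principal_iff] at hb
  obtain ⟨V, hV⟩ := eventually_atTop.1 (hb.and hg)
  refine ⟨c', hc', V, fun v hv x hx => ?_⟩
  have := (hV v hv).1 x hx
  rwa [Real.norm_eq_abs, Real.norm_of_nonneg (hV v hv).2] at this

end Uniform

theorem tendsto_log_log_pow_div_log (n : ℕ) :
    Tendsto (fun v => Real.log (Real.log v) ^ n / Real.log v) atTop (𝓝 0) := by
  have h := (Real.isLittleO_pow_log_id_atTop (n := n)).tendsto_div_nhds_zero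
  exact h.comp Real.tendsto_log_atTop

/-- The relative increment of `log w` over `log v`, for `w = a_t(v) + b_t(v) x`. -/
theorem log_norming_argument {κ γ c : ℝ} (hκ : 0 < κ) (t : ℕ) {v x : ℝ} (hv : 0 < v)
    (hL : 0 < Real.log v)
    (hF : 0 < 1 + zetaHT c t / γ ^ 2 * (Real.log (Real.log v) / Real.log v))
    (hG : 0 < 1 + x / Real.log v) :
    Real.log (aIMS κ γ c t v + bIMS κ γ c t v * x) / Real.log v =
      1 + (-(t : ℝ) / γ * (Real.log (Real.log v) / Real.log v - Real.log κ / Real.log v)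
        + (Real.log (1 + zetaHT c t / γ ^ 2 * (Real.log (Real.log v) / Real.log v))
          + Real.log (1 + x / Real.log v)) / Real.log v) := by
  have hw : aIMS κ γ c t v + bIMS κ γ c t v * x = v * (Real.log v / κ) ^ (-(t : ℝ) / γ)
      * (1 + zetaHT c t / γ ^ 2 * (Real.log (Real.log v) / Real.log v))
      * (1 + x / Real.log v) := by
    unfold bIMS aIMS; ring
  have hR : 0 < (Real.log v / κ) ^ (-(t : ℝ) / γ) := Real.rpow_pos_of_pos (div_pos hL hκ) _
  rw [hw, Real.log_mul (by positivity) hG.ne', Real.log_mul (by positivity) hF.ne',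
    Real.log_mul hv.ne' hR.ne', Real.log_rpow (div_pos hL hκ), Real.log_div hL.ne' hκ.ne']
  generalize Real.log (1 + x / Real.log v) = A
  generalize Real.log (1 + zetaHT c t / γ ^ 2 * (Real.log (Real.log v) / Real.log v)) = B
  rw [← sub_div, ← mul_div_assoc, ← add_div, ← div_self hL.ne', ← add_div]
  ring

theorem aIMS_one_norming_argument {κ γ c : ℝ} (hκ : 0 < κ) (t : ℕ) {v x Q : ℝ}
    (hL : 0 < Real.log v) (hQ : 0 < Q)
    (hw : Real.log (aIMS κ γ c t v + bIMS κ γ c t v * x) / Real.log v = Q) :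
    aIMS κ γ c 1 (aIMS κ γ c t v + bIMS κ γ c t v * x) =
      v * (Real.log v / κ) ^ (-((t + 1 : ℕ) : ℝ) / γ) *
        ((1 + zetaHT c t / γ ^ 2 * (Real.log (Real.log v) / Real.log v))
          * (1 + x / Real.log v) * Q ^ (-1 / γ)
          * (1 + c / γ ^ 2 * ((Real.log (Real.log v) / Real.log v
            + Real.log Q / Real.log v) * Q⁻¹))) := by
  rw [div_eq_iff hL.ne'] at hw
  have hz : zetaHT c 1 = c := by simp [zetaHT]
  have hr : (Q * Real.log v / κ) ^ (-((1 : ℕ) : ℝ) / γ)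
      = Q ^ (-1 / γ) * (Real.log v / κ) ^ (-1 / γ) := by
    rw [mul_div_assoc, Real.mul_rpow hQ.le (div_pos hL hκ).le, Nat.cast_one]
  have ht : (Real.log v / κ) ^ (-((t + 1 : ℕ) : ℝ) / γ)
      = (Real.log v / κ) ^ (-(t : ℝ) / γ) * (Real.log v / κ) ^ (-1 / γ) := by
    rw [← Real.rpow_add (div_pos hL hκ)]
    congr 1
    push_cast
    ring
  have hll : Real.log (Q * Real.log v) / (Q * Real.log v)
      = (Real.log (Real.log v) / Real.log v + Real.log Q / Real.log v) * Q⁻¹ := by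
    rw [Real.log_mul hQ.ne' hL.ne']
    field_simp
    ring
  rw [aIMS.eq_1 κ γ c 1, hw, hz, hr, hll, ht]
  unfold bIMS aIMS
  ring

/-- First-order expansions of `a_1(w)`, `a_{t+1}(v)` and `log w`, where
`w = a_t(v) + b_t(v) x`, relative to `v (log v / κ)^{-(t+1)/γ}` and `log v`. -/
theorem exists_norming_expansions {κ γ : ℝ} (c : ℝ) (hκ : 0 < κ) {t : ℕ} (ht : 1 ≤ t)
    {l : Filter (ℝ × ℝ)} {L ε : ℝ × ℝ → ℝ} (hLdef : ∀ p, L p = Real.log p.1)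
    (hεdef : ∀ p, ε p = Real.log (Real.log p.1) / Real.log p.1)
    (hv : Tendsto Prod.fst l atTop) (hε : Tendsto ε l (𝓝 0))
    (hLε : (fun p => (L p)⁻¹) =O[l] ε) (hx : Prod.snd =O[l] (fun _ => (1 : ℝ))) :
    ∃ (N P D Q β θ : ℝ × ℝ → ℝ), (∀ᶠ p in l, 0 < N p ∧
        aIMS κ γ c 1 (aIMS κ γ c t p.1 + bIMS κ γ c t p.1 * p.2) = N p * P p ∧
        aIMS κ γ c (t + 1) p.1 = N p * D p ∧
        Real.log (aIMS κ γ c t p.1 + bIMS κ γ c t p.1 * p.2) = L p * Q p) ∧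
      HasFirstOrderExpansion l ε P
        (fun p => β p + (p.2 - (t : ℝ) / γ ^ 2 * Real.log κ) / L p) ∧
      HasFirstOrderExpansion l ε D β ∧ HasFirstOrderExpansion l ε Q θ := by
  have hLt : Tendsto L l atTop := by
    simpa only [Function.comp_def, ← hLdef] using Real.tendsto_log_atTop.comp hv
  have hdiv : ∀ {u : ℝ × ℝ → ℝ}, u =O[l] (fun _ => (1 : ℝ)) → (fun p => u p / L p) =O[l] ε :=
    fun hu => by simpa [div_eq_mul_inv] using hu.mul hLε
  have hdiv2 : ∀ {u : ℝ × ℝ → ℝ}, u =O[l] ε → (fun p => u p / L p) =O[l] (fun p => ε p ^ 2) :=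
    fun hu => by simpa [div_eq_mul_inv, sq] using hu.mul hLε
  have hscale (r : ℝ) : (fun p => r * ε p) =O[l] ε :=
    (Asymptotics.isBigO_refl ε l).const_mul_left r
  have hF := HasFirstOrderExpansion.one_add (hscale (zetaHT c t / γ ^ 2))
  have hG := HasFirstOrderExpansion.one_add (hdiv hx)
  have hθ : (fun p => -(t : ℝ) / γ * (ε p - Real.log κ / L p)) =O[l] ε :=
    ((Asymptotics.isBigO_refl ε l).sub
      (hdiv (Asymptotics.isBigO_const_const _ one_ne_zero _))).const_mul_left _
  set F : ℝ × ℝ → ℝ := fun p => 1 + zetaHT c t / γ ^ 2 * ε p with hFdef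
  set G : ℝ × ℝ → ℝ := fun p => 1 + p.2 / L p with hGdef
  set Q : ℝ × ℝ → ℝ := fun p => 1 + (-(t : ℝ) / γ * (ε p - Real.log κ / L p)
    + (Real.log (F p) + Real.log (G p)) / L p) with hQdef
  have hQ : HasFirstOrderExpansion l ε Q (fun p => -(t : ℝ) / γ * (ε p - Real.log κ / L p)) := by
    refine ⟨?_, hθ⟩
    refine (hdiv2 ((hF.log_isBigO hε).add (hG.log_isBigO hε))).congr_left fun p => ?_
    simp only [hQdef]
    ring
  have hQi := hQ.inv hε
  have hH : HasFirstOrderExpansion l ε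
      (fun p => 1 + c / γ ^ 2 * ((ε p + Real.log (Q p) / L p) * (Q p)⁻¹))
      (fun p => c / γ ^ 2 * ε p) := by
    refine ⟨?_, hscale _⟩
    have h1 := (Asymptotics.isBigO_refl ε l).mul (hQi.sub_one_isBigO hε)
    have h2 := (hdiv2 (hQ.log_isBigO hε)).mul ((hQi.tendsto_one hε).isBigO_one ℝ)
    simp only [← sq, mul_one] at h1 h2
    refine ((h1.add h2).const_mul_left (c / γ ^ 2)).congr_left fun p => ?_
    ring
  have hP := ((hF.mul hG hε).mul (hQ.rpow hε (-1 / γ)) hε).mul hH hε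
  refine ⟨fun p => p.1 * (L p / κ) ^ (-((t + 1 : ℕ) : ℝ) / γ),
    fun p => F p * G p * Q p ^ (-1 / γ)
      * (1 + c / γ ^ 2 * ((ε p + Real.log (Q p) / L p) * (Q p)⁻¹)),
    fun p => 1 + zetaHT c (t + 1) / γ ^ 2 * ε p, Q, fun p => zetaHT c (t + 1) / γ ^ 2 * ε p, _,
    ?_, ?_, HasFirstOrderExpansion.one_add (hscale _), hQ⟩
  rotate_left
  · convert hP using 2 with p
    rw [zetaHT_succ c ht]
    ring
  · filter_upwards [hv.eventually_gt_atTop 0, hLt.eventually_gt_atTop 0,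
      (hF.tendsto_one hε).eventually (lt_mem_nhds one_pos),
      (hG.tendsto_one hε).eventually (lt_mem_nhds one_pos),
      (hQ.tendsto_one hε).eventually (lt_mem_nhds one_pos)] with p hp hLp hFp hGp hQp
    have hw : Real.log (aIMS κ γ c t p.1 + bIMS κ γ c t p.1 * p.2) / Real.log p.1 = Q p := by
      simp only [hQdef, hFdef, hGdef, hLdef, hεdef] at hLp hFp hGp ⊢
      exact log_norming_argument hκ t hp hLp hFp hGp
    refine ⟨mul_pos hp (Real.rpow_pos_of_pos (div_pos hLp hκ) _), ?_, ?_, ?_⟩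
    · rw [hLdef] at hLp
      rw [aIMS_one_norming_argument hκ t hLp hQp hw]
      simp only [hFdef, hGdef, hLdef, hεdef]
    · simp only [aIMS, hLdef, hεdef]
    · rw [hLdef] at hLp ⊢
      rw [← hw, mul_div_cancel₀ _ hLp.ne']

theorem norming_updates_isBigO {κ γ : ℝ} (c : ℝ) (hκ : 0 < κ) {t : ℕ} (ht : 1 ≤ t)
    {C : Set ℝ} (hC : IsCompact C) :
    ((fun p : ℝ × ℝ => (aIMS κ γ c 1 (aIMS κ γ c t p.1 + bIMS κ γ c t p.1 * p.2)
        - aIMS κ γ c (t + 1) p.1) / bIMS κ γ c (t + 1) p.1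
        - (p.2 - (t : ℝ) / γ ^ 2 * Real.log κ))
      =O[atTop ×ˢ 𝓟 C] (fun p => Real.log (Real.log p.1) ^ 2 / Real.log p.1)) ∧
    ((fun p : ℝ × ℝ => bIMS κ γ c 1 (aIMS κ γ c t p.1 + bIMS κ γ c t p.1 * p.2)
        / bIMS κ γ c (t + 1) p.1 - 1)
      =O[atTop ×ˢ 𝓟 C] (fun p => Real.log (Real.log p.1) / Real.log p.1)) := by
  set l : Filter (ℝ × ℝ) := atTop ×ˢ 𝓟 C
  set L : ℝ × ℝ → ℝ := fun p => Real.log p.1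
  set ε : ℝ × ℝ → ℝ := fun p => Real.log (Real.log p.1) / Real.log p.1
  have hv : Tendsto Prod.fst l atTop := tendsto_fst
  have hLt : Tendsto L l atTop := Real.tendsto_log_atTop.comp hv
  have hℓt : Tendsto (fun p => Real.log (L p)) l atTop := Real.tendsto_log_atTop.comp hLt
  have hε : Tendsto ε l (𝓝 0) := by
    simpa [Function.comp_def] using (tendsto_log_log_pow_div_log 1).comp hv
  have hLε : (fun p => (L p)⁻¹) =O[l] ε := by
    refine Asymptotics.IsBigO.of_bound 1 ?_
    filter_upwards [hLt.eventually_gt_atTop 0, hℓt.eventually_ge_atTop 1] with p hL hℓ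
    rw [one_mul, norm_inv, norm_div, ← one_div]
    gcongr
    exact hℓ.trans (le_abs_self _)
  have hx : Prod.snd =O[l] (fun _ => (1 : ℝ)) := by
    obtain ⟨R, hR⟩ := hC.isBounded.exists_norm_le
    refine Asymptotics.IsBigO.of_bound R ?_
    rw [eventually_prod_principal_iff]
    exact Eventually.of_forall fun v x hxC => by simpa using hR x hxC
  have hε2 : ε =O[l] (fun p => Real.log (Real.log p.1) ^ 2 / Real.log p.1) := by
    refine Asymptotics.IsBigO.of_bound 1 ?_
    filter_upwards [hℓt.eventually_ge_atTop 1] with p hℓ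
    rw [one_mul, norm_div, norm_div, norm_pow]
    gcongr
    exact le_self_pow₀ (hℓ.trans (le_abs_self _)) two_ne_zero
  obtain ⟨N, P, D, Q, β, θ, hev, hP, hD, hQ⟩ :=
    exists_norming_expansions (γ := γ) c hκ ht (L := L) (fun _ => rfl) (fun _ => rfl) hv hε hLε hx
  have hDi := hD.inv hε
  have hDpos := (hD.tendsto_one hε).eventually (lt_mem_nhds one_pos)
  have hQpos := (hQ.tendsto_one hε).eventually (lt_mem_nhds one_pos)
  constructor
  · have hm : (fun p : ℝ × ℝ => p.2 - (t : ℝ) / γ ^ 2 * Real.log κ) =O[l] (fun _ => (1 : ℝ)) :=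
      hx.sub (Asymptotics.isBigO_const_const _ one_ne_zero _)
    have h1 := (((hP.1.sub hD.1).mul (Asymptotics.isBigO_refl L l)).mul
      ((hDi.tendsto_one hε).isBigO_one ℝ))
    have h2 := hm.mul (hDi.sub_one_isBigO hε)
    simp only [mul_one, one_mul] at h1 h2
    have hsq : (fun p => ε p ^ 2 * L p) =O[l]
        (fun p => Real.log (Real.log p.1) ^ 2 / Real.log p.1) := by
      refine Asymptotics.IsBigO.of_bound 1 ?_
      filter_upwards [hLt.eventually_gt_atTop 0] with p hL
      have hL : Real.log p.1 ≠ 0 := hL.ne'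
      rw [one_mul]
      refine le_of_eq (congrArg _ ?_)
      simp only [ε, L]
      field_simp
    refine ((h1.trans hsq).add (h2.trans hε2)).congr' ?_ EventuallyEq.rfl
    filter_upwards [hev, hDpos, hLt.eventually_gt_atTop 0] with p ⟨hN, ha, ha', _⟩ hDp hL
    have hN := hN.ne'
    have hDp := hDp.ne'
    have hL' : Real.log p.1 ≠ 0 := hL.ne'
    rw [bIMS.eq_1 κ γ c (t + 1), ha, ha']
    simp only [L]
    field_simp
    ring
  · refine (((hP.mul hDi hε).mul (hQ.inv hε) hε).sub_one_isBigO hε).congr' ?_ EventuallyEq.rfl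
    filter_upwards [hev, hDpos, hQpos, hLt.eventually_gt_atTop 0]
      with p ⟨hN, ha, ha', hlog⟩ hDp hQp hL
    have hN := hN.ne'
    have hDp := hDp.ne'
    have hQp := hQp.ne'
    have hL' : Real.log p.1 ≠ 0 := hL.ne'
    rw [bIMS.eq_1 κ γ c (t + 1), bIMS.eq_1 κ γ c 1, ha, ha', hlog]
    simp only [L]
    field_simp

/-- Example 4 (ii) (normings for the inverted max-stable copula with a different type of
decay): for `κ, γ > 0`, `δ ∈ ℝ` and `c = δ + 2(1+γ)`, for every `t ≥ 1`, as `v → ∞`,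
(i) `[a(a_t(v)+b_t(v)x) - a_{t+1}(v)]/b_{t+1}(v) → x - (t/γ²) log κ`, with remainder of
order `O((log log v)²/log v)`, and (ii) `b(a_t(v)+b_t(v)x)/b_{t+1}(v) → 1`, with remainder
of order `O(log log v/log v)`, both uniformly on compact sets in `x ∈ ℝ`. Hence
`ψ^a_{t+1}(x) = x - (t/γ²) log κ` and `ψ^b_{t+1}(x) = 1`, giving the random walk tail
chain with drift `M_{t+1} = M_t - (t/γ²) log κ + ε_{t+1}`. -/
theorem extreme_events_inverted_ms_norming
    (κ γ δ : ℝ) (hκ : 0 < κ) (hγ : 0 < γ) (c : ℝ) (hc : c = δ + 2 * (1 + γ)) :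
    ∀ t : ℕ, 1 ≤ t → ∀ C : Set ℝ, IsCompact C →
      -- (i) the location update ratio converges to `x - (t/γ²) log κ`
      (TendstoUniformlyOn
        (fun v x => (aIMS κ γ c 1 (aIMS κ γ c t v + bIMS κ γ c t v * x)
            - aIMS κ γ c (t + 1) v) / bIMS κ γ c (t + 1) v)
        (fun x => x - (t : ℝ) / γ ^ 2 * Real.log κ) atTop C) ∧
      -- with remainder of order `O((log log v)²/log v)`
      (∃ c' : ℝ, 0 < c' ∧ ∃ V : ℝ, ∀ v : ℝ, V ≤ v → ∀ x ∈ C,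
        |(aIMS κ γ c 1 (aIMS κ γ c t v + bIMS κ γ c t v * x)
            - aIMS κ γ c (t + 1) v) / bIMS κ γ c (t + 1) v
          - (x - (t : ℝ) / γ ^ 2 * Real.log κ)|
          ≤ c' * (Real.log (Real.log v)) ^ 2 / Real.log v) ∧
      -- (ii) the scale update ratio converges to `1`
      (TendstoUniformlyOn
        (fun v x => bIMS κ γ c 1 (aIMS κ γ c t v + bIMS κ γ c t v * x)
          / bIMS κ γ c (t + 1) v)
        (fun _ => 1) atTop C) ∧
      -- with remainder of order `O(log log v/log v)`
      (∃ c' : ℝ, 0 < c' ∧ ∃ V : ℝ, ∀ v : ℝ, V ≤ v → ∀ x ∈ C,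
        |bIMS κ γ c 1 (aIMS κ γ c t v + bIMS κ γ c t v * x) / bIMS κ γ c (t + 1) v - 1|
          ≤ c' * Real.log (Real.log v) / Real.log v) := by
  intro t ht C hC
  obtain ⟨h1, h2⟩ := norming_updates_isBigO (γ := γ) c hκ ht hC
  have hlog := Real.tendsto_log_atTop
  simp only [mul_div_assoc]
  refine ⟨tendstoUniformlyOn_of_isBigO h1 (tendsto_log_log_pow_div_log 2),
    exists_uniform_bound_of_isBigO h1 ?_,
    tendstoUniformlyOn_of_isBigO (f := fun _ => 1) h2
      (by simpa using tendsto_log_log_pow_div_log 1),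
    exists_uniform_bound_of_isBigO (f := fun _ => 1) h2 ?_⟩
  · filter_upwards [hlog.eventually_ge_atTop 0] with v hv
    positivity
  · filter_upwards [hlog.eventually_ge_atTop 0, (hlog.comp hlog).eventually_ge_atTop 0]
      with v hv hv'
    exact div_nonneg hv' hv
end

section
/- Let γ > 0 and define a_t(v) = v exp(−γ t (2 log v)^{1/2} + γ t (log log v)/(log v) + (γt)²/2) and b_t(v) = a_t(v)/(log v)^{1/2} for t ≥ 1, with a = a_1 and b = b_1. Then for every t ≥ 1, as v ↑ ∞: (i) [a(a_t(v)+b_t(v)x) − a_{t+1}(v)]/b_{t+1}(v) → x; and (ii) b(a_t(v)+b_t(v)x)/b_{t+1}(v) → 1; both uniformly on compact sets in x ∈ ℝ, with remainder terms of order O((log v)^{−1/2}). Hence the update functions are ψ^a_{t+1}(x) = x and ψ^b_{t+1}(x) = 1, giving the random walk tail chain M_{t+1} = M_t + ε_{t+1}. -/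
open Filter Topology

/-- The `t`-step location norming for the inverted Hüsler–Reiss / Smith example:
`a_t(v) = v exp(-γt(2 log v)^{1/2} + γt (log log v)/(log v) + (γt)²/2)`. -/
noncomputable def aHR (γ : ℝ) (t : ℕ) (v : ℝ) : ℝ :=
  v * Real.exp (-(γ * t) * Real.sqrt (2 * Real.log v)
    + γ * t * Real.log (Real.log v) / Real.log v + (γ * t) ^ 2 / 2)

/-- The `t`-step scale norming `b_t(v) = a_t(v)/(log v)^{1/2}`. -/
noncomputable def bHR (γ : ℝ) (t : ℕ) (v : ℝ) : ℝ :=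
  aHR γ t v / Real.sqrt (Real.log v)

theorem abs_log_one_add_le {y : ℝ} (hy : |y| ≤ 1 / 2) : |Real.log (1 + y)| ≤ 2 * |y| := by
  obtain ⟨h1, h2⟩ := abs_le.mp hy
  have hp : 0 < 1 + y := by linarith
  have hup := Real.log_le_sub_one_of_pos hp
  have hlow := Real.one_sub_inv_le_log_of_pos hp
  have hinv : -(2 * |y|) ≤ 1 - (1 + y)⁻¹ := by
    have : 1 - (1 + y)⁻¹ = y / (1 + y) := by field_simp; ring
    rw [this, le_div_iff₀ hp]
    nlinarith [neg_abs_le y, abs_nonneg y]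
  rw [abs_le]
  constructor <;> linarith [le_abs_self y, abs_nonneg y]

/-- The logarithm of `a_t(v) + b_t(v) x`, in terms of `s = (log v)^{1/2}` and `d = γt / √2`. -/
noncomputable def logArg (d s x : ℝ) : ℝ :=
  (s - d) ^ 2 + (√2 * d * Real.log (s ^ 2) / s ^ 2 + Real.log (1 + x / s))

theorem abs_logArg_sub_sq_le {d R s x : ℝ} (hd : 0 ≤ d) (hs : 4 * (1 + d + R) ≤ s)
    (hx : |x| ≤ R) :
    |logArg d s x - (s - d) ^ 2| ≤ (4 * d + 2 * R) / s := by
  have hR : 0 ≤ R := (abs_nonneg x).trans hx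
  have hs0 : 0 < s := by linarith
  have hxs : |x / s| ≤ R / s := by rw [abs_div, abs_of_pos hs0]; gcongr
  have hlog1 : |Real.log (1 + x / s)| ≤ 2 * (R / s) := by
    refine (abs_log_one_add_le (hxs.trans ?_)).trans (by linarith)
    rw [div_le_iff₀ hs0]; linarith
  have hlogs : 0 ≤ Real.log s := Real.log_nonneg (by linarith)
  have hlogs' : Real.log s ≤ s := (Real.log_le_sub_one_of_pos hs0).trans (by linarith)
  have hsqrt : √2 ≤ 2 := Real.sqrt_le_iff.mpr (by norm_num)
  have hlog2 : |√2 * d * Real.log (s ^ 2) / s ^ 2| ≤ 4 * d / s := by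
    rw [Real.log_pow, abs_of_nonneg (by positivity), div_le_div_iff₀ (by positivity) hs0]
    calc √2 * d * (((2 : ℕ) : ℝ) * Real.log s) * s
        ≤ 2 * d * (((2 : ℕ) : ℝ) * s) * s := by gcongr
      _ = 4 * d * s ^ 2 := by push_cast; ring
  calc |logArg d s x - (s - d) ^ 2|
      = |√2 * d * Real.log (s ^ 2) / s ^ 2 + Real.log (1 + x / s)| := by
        rw [logArg, add_sub_cancel_left]
    _ ≤ 4 * d / s + 2 * (R / s) := (abs_add_le _ _).trans (add_le_add hlog2 hlog1)
    _ = (4 * d + 2 * R) / s := by ring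

theorem half_sq_le_logArg {d R s x : ℝ} (hd : 0 ≤ d) (hs : 4 * (1 + d + R) ≤ s)
    (hx : |x| ≤ R) : s ^ 2 / 2 ≤ logArg d s x := by
  have hR : 0 ≤ R := (abs_nonneg x).trans hx
  have hs0 : 0 < s := by linarith
  have h := (abs_le.mp (abs_logArg_sub_sq_le hd hs hx)).1
  have hN : (4 * d + 2 * R) / s ≤ 1 := by rw [div_le_one hs0]; linarith
  have h1 : (3 / 4 * s) ^ 2 ≤ (s - d) ^ 2 := by
    apply pow_le_pow_left₀ (by positivity); linarith
  nlinarith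

theorem abs_logArg_sub_le {d R s x : ℝ} (hd : 0 ≤ d) (hs : 4 * (1 + d + R) ≤ s)
    (hx : |x| ≤ R) : |logArg d s x - s ^ 2| ≤ (7 * d + 2 * R) * s := by
  have hR : 0 ≤ R := (abs_nonneg x).trans hx
  have hs0 : 0 < s := by linarith
  have h := abs_le.mp (abs_logArg_sub_sq_le hd hs hx)
  have hN : (4 * d + 2 * R) / s ≤ (4 * d + 2 * R) * s := by
    rw [div_le_iff₀ hs0, mul_assoc]
    exact le_mul_of_one_le_right (by positivity) (by nlinarith)
  rw [abs_le]
  constructor <;> nlinarith [mul_nonneg hd hs0.le]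

theorem half_le_sqrt_logArg {d R s x : ℝ} (hd : 0 ≤ d) (hs : 4 * (1 + d + R) ≤ s)
    (hx : |x| ≤ R) : s / 2 ≤ √(logArg d s x) := by
  apply Real.le_sqrt_of_sq_le
  nlinarith [half_sq_le_logArg hd hs hx, sq_nonneg s]

theorem abs_sqrt_logArg_sub_le {d R s x : ℝ} (hd : 0 ≤ d) (hs : 4 * (1 + d + R) ≤ s)
    (hx : |x| ≤ R) : |√(logArg d s x) - (s - d)| ≤ (8 * d + 4 * R) / s ^ 2 := by
  have hR : 0 ≤ R := (abs_nonneg x).trans hx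
  have hs0 : 0 < s := by linarith
  have hr := half_le_sqrt_logArg hd hs hx
  have hsq := Real.sq_sqrt ((by positivity : 0 ≤ s ^ 2 / 2).trans (half_sq_le_logArg hd hs hx))
  have h := abs_logArg_sub_sq_le hd hs hx
  rw [← hsq] at h
  set r := √(logArg d s x)
  have hsum : 0 < r + (s - d) := by linarith
  have hfac : |r - (s - d)| * (r + (s - d)) = |r ^ 2 - (s - d) ^ 2| := by
    rw [sq_sub_sq, abs_mul, abs_of_pos hsum, mul_comm]
  have h2 : |r - (s - d)| * (s / 2) ≤ (4 * d + 2 * R) / s := by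
    refine le_trans ?_ (hfac.trans_le h)
    gcongr
    linarith
  rw [le_div_iff₀ (by positivity)]
  rw [le_div_iff₀ hs0] at h2
  linarith

theorem abs_log_div_logArg_sub_le {d R s x : ℝ} (hd : 0 ≤ d) (hs : 4 * (1 + d + R) ≤ s)
    (hx : |x| ≤ R) :
    |Real.log (logArg d s x) / logArg d s x - Real.log (s ^ 2) / s ^ 2|
      ≤ 8 * (7 * d + 2 * R) / s ^ 2 := by
  have hR : 0 ≤ R := (abs_nonneg x).trans hx
  have hs0 : 0 < s := by linarith
  have hP := half_sq_le_logArg hd hs hx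
  have hdiff := abs_logArg_sub_le hd hs hx
  set P := logArg d s x
  have hM : 0 ≤ 7 * d + 2 * R := by positivity
  generalize 7 * d + 2 * R = M at *
  have hP0 : 0 < P := lt_of_lt_of_le (by positivity) hP
  have hlogdiff : |Real.log P - Real.log (s ^ 2)| ≤ 2 * M / s := by
    have hs2 : 0 < s ^ 2 := by positivity
    obtain ⟨h1, h2⟩ := abs_le.mp hdiff
    rw [← Real.log_div hP0.ne' hs2.ne', abs_le]
    constructor
    · refine le_trans ?_ (Real.one_sub_inv_le_log_of_pos (div_pos hP0 hs2))
      have : 1 - (P / s ^ 2)⁻¹ = (P - s ^ 2) / P := by field_simp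
      rw [this, ← neg_div, div_le_div_iff₀ hs0 hP0]
      nlinarith [mul_le_mul_of_nonneg_left hP hM, mul_le_mul_of_nonneg_right h1 hs0.le]
    · refine (Real.log_le_sub_one_of_pos (div_pos hP0 hs2)).trans ?_
      have : P / s ^ 2 - 1 = (P - s ^ 2) / s ^ 2 := by field_simp
      rw [this, div_le_div_iff₀ hs2 hs0]
      nlinarith [mul_le_mul_of_nonneg_right h2 hs0.le, mul_nonneg hM hs2.le]
  have hlogs : 0 ≤ Real.log s := Real.log_nonneg (by linarith)
  have hlogs' : Real.log s ≤ s := (Real.log_le_sub_one_of_pos hs0).trans (by linarith)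
  have hsplit : Real.log P / P - Real.log (s ^ 2) / s ^ 2
      = (Real.log P - Real.log (s ^ 2)) / P
        + Real.log (s ^ 2) * (s ^ 2 - P) / (P * s ^ 2) := by
    field_simp; ring
  have hfirst : |(Real.log P - Real.log (s ^ 2)) / P| ≤ 4 * M / s ^ 2 := by
    rw [abs_div, abs_of_pos hP0]
    calc |Real.log P - Real.log (s ^ 2)| / P ≤ (2 * M / s) / (s ^ 2 / 2) := by gcongr
      _ = 4 * M / s ^ 2 / s := by field_simp; ring
      _ ≤ 4 * M / s ^ 2 := div_le_self (by positivity) (by linarith)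
  have hsecond : |Real.log (s ^ 2) * (s ^ 2 - P) / (P * s ^ 2)| ≤ 4 * M / s ^ 2 := by
    rw [abs_div, abs_mul, abs_sub_comm, Real.log_pow, abs_of_pos (by positivity : 0 < P * s ^ 2),
      abs_of_nonneg (by positivity : 0 ≤ ((2 : ℕ) : ℝ) * Real.log s)]
    calc ((2 : ℕ) : ℝ) * Real.log s * |P - s ^ 2| / (P * s ^ 2)
        ≤ ((2 : ℕ) : ℝ) * s * (M * s) / (s ^ 2 / 2 * s ^ 2) := by gcongr
      _ = 4 * M / s ^ 2 := by push_cast; field_simp; ring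
  rw [hsplit]
  refine (abs_add_le _ _).trans ((add_le_add hfirst hsecond).trans_eq ?_)
  ring

/-- The correction exponent `E` in `a(a_t(v) + b_t(v) x) = a_{t+1}(v) (1 + x/s) exp(E)`. -/
noncomputable def corrExp (γ d s x : ℝ) : ℝ :=
  -(γ * √2) * (√(logArg d s x) - (s - d))
    + γ * (Real.log (logArg d s x) / logArg d s x - Real.log (s ^ 2) / s ^ 2)

theorem abs_corrExp_le {γ d R s x : ℝ} (hγ : 0 < γ) (hd : 0 ≤ d) (hs : 4 * (1 + d + R) ≤ s)
    (hx : |x| ≤ R) : |corrExp γ d s x| ≤ γ * (72 * d + 24 * R) / s ^ 2 := by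
  have hR : 0 ≤ R := (abs_nonneg x).trans hx
  have hsqrt : √2 ≤ 2 := Real.sqrt_le_iff.mpr (by norm_num)
  have h1 : |-(γ * √2) * (√(logArg d s x) - (s - d))|
      ≤ γ * 2 * ((8 * d + 4 * R) / s ^ 2) := by
    rw [abs_mul, abs_neg, abs_of_pos (by positivity : 0 < γ * √2)]
    gcongr
    exact abs_sqrt_logArg_sub_le hd hs hx
  have h2 : |γ * (Real.log (logArg d s x) / logArg d s x - Real.log (s ^ 2) / s ^ 2)|
      ≤ γ * (8 * (7 * d + 2 * R) / s ^ 2) := by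
    rw [abs_mul, abs_of_pos hγ]
    gcongr
    exact abs_log_div_logArg_sub_le hd hs hx
  refine (abs_add_le _ _).trans ((add_le_add h1 h2).trans_eq ?_)
  ring

theorem aHR_pos (γ : ℝ) (t : ℕ) {v : ℝ} (hv : 0 < v) : 0 < aHR γ t v :=
  mul_pos hv (Real.exp_pos _)

theorem aHR_add_bHR_mul (γ : ℝ) (t : ℕ) (v x : ℝ) :
    aHR γ t v + bHR γ t v * x = aHR γ t v * (1 + x / √(Real.log v)) := by
  rw [bHR]; ring

theorem log_aHR_add_bHR_mul {γ d v x : ℝ} {t : ℕ} (hd : γ * t = √2 * d) (hv : 1 < v)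
    (hx : 0 < 1 + x / √(Real.log v)) :
    Real.log (aHR γ t v + bHR γ t v * x) = logArg d √(Real.log v) x := by
  have hv0 : 0 < v := by linarith
  have hs2 : √(Real.log v) ^ 2 = Real.log v := Real.sq_sqrt (Real.log_pos hv).le
  have h2 : √2 ^ 2 = (2 : ℝ) := Real.sq_sqrt (by norm_num)
  rw [aHR_add_bHR_mul, Real.log_mul (aHR_pos γ t hv0).ne' hx.ne', aHR,
    Real.log_mul hv0.ne' (Real.exp_pos _).ne', Real.log_exp, Real.sqrt_mul (by norm_num), hd,
    logArg, hs2]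
  linear_combination (-1 : ℝ) * hs2 + (d ^ 2 / 2 - d * √(Real.log v)) * h2

theorem aHR_one_comp {γ d v x : ℝ} {t : ℕ} (hd : γ * t = √2 * d) (hv : 1 < v)
    (hx : 0 < 1 + x / √(Real.log v)) :
    aHR γ 1 (aHR γ t v + bHR γ t v * x) = aHR γ (t + 1) v *
      ((1 + x / √(Real.log v)) * Real.exp (corrExp γ d √(Real.log v) x)) := by
  have hs2 : √(Real.log v) ^ 2 = Real.log v := Real.sq_sqrt (Real.log_pos hv).le
  rw [aHR, log_aHR_add_bHR_mul hd hv hx, aHR_add_bHR_mul, aHR, aHR]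
  have collect : ∀ y a b c e : ℝ, a + b = c + e →
      v * Real.exp a * y * Real.exp b = v * Real.exp c * (y * Real.exp e) := by
    intro y a b c e h
    have h' := congrArg Real.exp h
    rw [Real.exp_add, Real.exp_add] at h'
    linear_combination v * y * h'
  apply collect
  rw [corrExp, hs2, Real.sqrt_mul (by norm_num), Real.sqrt_mul (by norm_num)]
  push_cast
  linear_combination (-γ) * hd

theorem tendstoUniformlyOn_of_abs_sub_le_div_sqrt_log {F : ℝ → ℝ → ℝ} {f : ℝ → ℝ} {C : Set ℝ}
    {c V : ℝ} (h : ∀ v, V ≤ v → ∀ x ∈ C, |F v x - f x| ≤ c / √(Real.log v)) :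
    TendstoUniformlyOn F f atTop C := by
  rw [Metric.tendstoUniformlyOn_iff]
  intro ε hε
  have hlim : Tendsto (fun v => c / √(Real.log v)) atTop (𝓝 0) :=
    (Real.tendsto_sqrt_atTop.comp Real.tendsto_log_atTop).const_div_atTop c
  filter_upwards [hlim.eventually_lt_const hε, eventually_ge_atTop V] with v hv hV x hx
  rw [dist_comm, Real.dist_eq]
  exact (h v hV x hx).trans_lt hv

/-- Error bounds for both update ratios, in terms of `s = (log v)^{1/2}`. -/
theorem abs_update_sub_le {γ d K R s x : ℝ} (hγ : 0 < γ) (hd : 0 ≤ d)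
    (hK : γ * (72 * d + 24 * R) ≤ K) (hs : 4 * (1 + d + R) + K ≤ s) (hx : |x| ≤ R) :
    |s * ((1 + x / s) * Real.exp (corrExp γ d s x) - 1) - x| ≤ 4 * K / s ∧
    |(1 + x / s) * Real.exp (corrExp γ d s x) * (s / √(logArg d s x)) - 1|
      ≤ (8 * K + 10 * R + 18 * d) / s := by
  have hR : 0 ≤ R := (abs_nonneg x).trans hx
  have hK0 : 0 ≤ K := le_trans (by positivity) hK
  have hs' : 4 * (1 + d + R) ≤ s := by linarith
  have hs0 : 0 < s := by linarith
  have hs1 : 1 ≤ s := by linarith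
  have hE : |corrExp γ d s x| ≤ K / s ^ 2 :=
    (abs_corrExp_le hγ hd hs' hx).trans (by gcongr)
  have hE1 : |corrExp γ d s x| ≤ 1 := hE.trans (by rw [div_le_one (by positivity)]; nlinarith)
  have hexp : |Real.exp (corrExp γ d s x) - 1| ≤ 2 * (K / s ^ 2) :=
    (Real.abs_exp_sub_one_le hE1).trans (by gcongr)
  have hr := half_le_sqrt_logArg hd hs' hx
  have hrd := abs_sqrt_logArg_sub_le hd hs' hx
  set e := Real.exp (corrExp γ d s x)
  set r := √(logArg d s x)
  have hr0 : 0 < r := lt_of_lt_of_le (by positivity) hr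
  have h1 : |s * ((1 + x / s) * e - 1) - x| ≤ 4 * K / s := by
    have : s * ((1 + x / s) * e - 1) - x = (s + x) * (e - 1) := by field_simp; ring
    rw [this, abs_mul]
    have hsx : |s + x| ≤ 2 * s := by
      rw [abs_le]; obtain ⟨_, _⟩ := abs_le.mp hx; constructor <;> linarith
    calc |s + x| * |e - 1| ≤ 2 * s * (2 * (K / s ^ 2)) := by gcongr
      _ = 4 * K / s := by field_simp; ring
  refine ⟨h1, ?_⟩
  have hratio : |(1 + x / s) * e - 1| ≤ (4 * K + R) / s := by
    rw [le_div_iff₀' hs0]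
    have h2 : 4 * K / s ≤ 4 * K := div_le_self (by positivity) hs1
    calc s * |(1 + x / s) * e - 1|
        = |(s * ((1 + x / s) * e - 1) - x) + x| := by
          rw [sub_add_cancel, abs_mul, abs_of_pos hs0]
      _ ≤ 4 * K + R := (abs_add_le _ _).trans (by linarith)
  have hq : |s / r| ≤ 2 := by
    rw [abs_of_pos (by positivity), div_le_iff₀ hr0]; linarith
  have hsr : |s - r| ≤ 9 * d + 4 * R := by
    have h2 : (8 * d + 4 * R) / s ^ 2 ≤ 8 * d + 4 * R :=
      div_le_self (by positivity) (by nlinarith)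
    obtain ⟨_, _⟩ := abs_le.mp hrd
    rw [abs_le]; constructor <;> linarith
  have hq1 : |s / r - 1| ≤ (18 * d + 8 * R) / s := by
    rw [div_sub_one hr0.ne', abs_div, abs_of_pos hr0]
    calc |s - r| / r ≤ (9 * d + 4 * R) / (s / 2) := by gcongr
      _ = (18 * d + 8 * R) / s := by field_simp; ring
  have hsplit : (1 + x / s) * e * (s / r) - 1
      = ((1 + x / s) * e - 1) * (s / r) + (s / r - 1) := by ring
  rw [hsplit]
  calc _ ≤ |(1 + x / s) * e - 1| * |s / r| + |s / r - 1| :=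
        (abs_add_le _ _).trans_eq (by rw [abs_mul])
    _ ≤ (4 * K + R) / s * 2 + (18 * d + 8 * R) / s := by gcongr
    _ = (8 * K + 10 * R + 18 * d) / s := by ring

/-- Example 4 (i) (normings for the inverted max-stable copula with Hüsler–Reiss
dependence): for every `t ≥ 1`, as `v → ∞`,
(i) `[a(a_t(v)+b_t(v)x) - a_{t+1}(v)]/b_{t+1}(v) → x` and
(ii) `b(a_t(v)+b_t(v)x)/b_{t+1}(v) → 1`, both uniformly on compact sets in `x ∈ ℝ`, with
remainder terms of order `O((log v)^{-1/2})`. Hence `ψ^a_{t+1}(x) = x`,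
`ψ^b_{t+1}(x) = 1`, giving the random walk tail chain `M_{t+1} = M_t + ε_{t+1}`. -/
theorem extreme_events_husler_reiss_norming
    (γ : ℝ) (hγ : 0 < γ) :
    ∀ t : ℕ, 1 ≤ t → ∀ C : Set ℝ, IsCompact C →
      -- (i) the location update ratio converges to `x`, uniformly on compacts
      (TendstoUniformlyOn
        (fun v x => (aHR γ 1 (aHR γ t v + bHR γ t v * x) - aHR γ (t + 1) v)
          / bHR γ (t + 1) v)
        (fun x => x) atTop C) ∧
      -- with remainder of order `O((log v)^{-1/2})`
      (∃ c : ℝ, 0 < c ∧ ∃ V : ℝ, ∀ v : ℝ, V ≤ v → ∀ x ∈ C,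
        |(aHR γ 1 (aHR γ t v + bHR γ t v * x) - aHR γ (t + 1) v) / bHR γ (t + 1) v - x|
          ≤ c / Real.sqrt (Real.log v)) ∧
      -- (ii) the scale update ratio converges to `1`, uniformly on compacts
      (TendstoUniformlyOn
        (fun v x => bHR γ 1 (aHR γ t v + bHR γ t v * x) / bHR γ (t + 1) v)
        (fun _ => 1) atTop C) ∧
      -- with remainder of order `O((log v)^{-1/2})`
      (∃ c : ℝ, 0 < c ∧ ∃ V : ℝ, ∀ v : ℝ, V ≤ v → ∀ x ∈ C,
        |bHR γ 1 (aHR γ t v + bHR γ t v * x) / bHR γ (t + 1) v - 1|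
          ≤ c / Real.sqrt (Real.log v)) := by
  intro t _ C hC
  obtain ⟨R₀, hRC⟩ := hC.isBounded.exists_norm_le
  obtain ⟨R, hR, hxR⟩ : ∃ R : ℝ, 0 ≤ R ∧ ∀ x ∈ C, |x| ≤ R :=
    ⟨max R₀ 0, le_max_right _ _, fun x hx => (hRC x hx).trans (le_max_left _ _)⟩
  obtain ⟨d, hd0, hd⟩ : ∃ d : ℝ, 0 ≤ d ∧ γ * t = √2 * d :=
    ⟨γ * t / √2, by positivity, by field_simp⟩
  set K := γ * (72 * d + 24 * R)
  have hK : 0 ≤ K := by positivity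
  obtain ⟨V, hV⟩ := eventually_atTop.mp
    (((Real.tendsto_sqrt_atTop.comp Real.tendsto_log_atTop).eventually_ge_atTop
      (4 * (1 + d + R) + K)).and (eventually_gt_atTop (1 : ℝ)))
  have key : ∀ v, V ≤ v → ∀ x ∈ C,
      |(aHR γ 1 (aHR γ t v + bHR γ t v * x) - aHR γ (t + 1) v) / bHR γ (t + 1) v - x|
        ≤ (4 * K + 1) / √(Real.log v) ∧
      |bHR γ 1 (aHR γ t v + bHR γ t v * x) / bHR γ (t + 1) v - 1|
        ≤ (8 * K + 10 * R + 18 * d + 1) / √(Real.log v) := by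
    intro v hv x hx
    obtain ⟨hs, hv1⟩ := hV v hv
    simp only [Function.comp_apply] at hs
    have hs0 : 0 < √(Real.log v) := by linarith
    have hA : aHR γ (t + 1) v ≠ 0 := (aHR_pos γ (t + 1) (by linarith)).ne'
    have hpos : 0 < 1 + x / √(Real.log v) := by
      have : -1 < x / √(Real.log v) := by
        rw [lt_div_iff₀ hs0]; linarith [(abs_le.mp (hxR x hx)).1]
      linarith
    obtain ⟨h1, h2⟩ := abs_update_sub_le hγ hd0 le_rfl hs (hxR x hx)
    have hr0 : 0 < √(logArg d √(Real.log v) x) := lt_of_lt_of_le (by positivity)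
      (half_le_sqrt_logArg hd0 (by linarith) (hxR x hx))
    constructor
    · rw [aHR_one_comp hd hv1 hpos, bHR]
      refine le_trans (le_of_eq ?_) (h1.trans ?_)
      · congr 2
        generalize (1 + x / √(Real.log v)) * Real.exp (corrExp γ d √(Real.log v) x) = ρ
        field_simp
      · exact div_le_div_of_nonneg_right (by linarith) hs0.le
    · rw [bHR.eq_1 γ 1, bHR.eq_1 γ (t + 1), log_aHR_add_bHR_mul hd hv1 hpos,
        aHR_one_comp hd hv1 hpos]
      refine le_trans (le_of_eq ?_) (h2.trans ?_)
      · congr 2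
        generalize (1 + x / √(Real.log v)) * Real.exp (corrExp γ d √(Real.log v) x) = ρ
        field_simp
      · exact div_le_div_of_nonneg_right (by linarith) hs0.le
  exact ⟨tendstoUniformlyOn_of_abs_sub_le_div_sqrt_log fun v hv x hx => (key v hv x hx).1,
    ⟨4 * K + 1, by positivity, V, fun v hv x hx => (key v hv x hx).1⟩,
    tendstoUniformlyOn_of_abs_sub_le_div_sqrt_log fun v hv x hx => (key v hv x hx).2,
    ⟨8 * K + 10 * R + 18 * d + 1, by positivity, V, fun v hv x hx => (key v hv x hx).2⟩⟩
end

section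
/- Let π_1 and π_2 be transition kernels on the standard exponential scale each stabilizing under a Heffernan–Tawn normalization: π_1(v, α_1 v + v^{β_1} dx) converges weakly to G_1(dx) and π_2(v, α_2 v + v^{β_2} dx) converges weakly to G_2(dx) as v ↑ ∞, where α_1, α_2 ∈ (0,1) with α_1 > α_2, β_1, β_2 ∈ [0,1), and G_1, G_2 are non-degenerate distributions on ℝ with continuous distribution functions. Let π = λπ_1 + (1−λ)π_2 for λ ∈ (0,1). Then π converges weakly on the extended real line with two distinct normalizations: for every x ∈ ℝ, lim_{v→∞} π(v, α_1 v + v^{β_1} x) = (1−λ) + λ G_1(x) (i.e., π(v, α_1 v + v^{β_1}dx) ⇒ K_1 = λG_1 + (1−λ)δ_{−∞}) and lim_{v→∞} π(v, α_2 v + v^{β_2} x) = (1−λ) G_2(x) (i.e., π(v, α_2 v + v^{β_2}dx) ⇒ K_2 = (1−λ)G_2 + λδ_{+∞}). -/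
open Filter Topology

/-- A sublinear perturbation does not affect the ordering of linear functions with distinct
slopes. -/
lemma eventually_linear_add_rpow_le {a b p q : ℝ} (hab : a < b) (hp : p < 1) (hq : q < 1)
    (x y : ℝ) : ∀ᶠ v : ℝ in atTop, a * v + v ^ p * y ≤ b * v + v ^ q * x := by
  have key : ∀ r : ℝ, r < 1 → ∀ z : ℝ,
      Tendsto (fun v : ℝ => v ^ (r - 1) * z) atTop (𝓝 0) := by
    intro r hr z
    have h := (tendsto_rpow_neg_atTop (sub_pos.2 hr)).mul_const z
    simpa using h
  have h : Tendsto (fun v : ℝ => a + v ^ (p - 1) * y - v ^ (q - 1) * x) atTop (𝓝 a) := by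
    simpa using ((key p hp y).const_add a).sub (key q hq x)
  filter_upwards [h.eventually_lt_const hab, eventually_gt_atTop 0] with v hv hpos
  have hmul := mul_lt_mul_of_pos_right hv hpos
  rw [Real.rpow_sub_one hpos.ne', Real.rpow_sub_one hpos.ne'] at hmul
  field_simp at hmul
  linarith

/-- Distribution functions evaluated eventually above every point of a convergent normalization
tend to one. -/
lemma tendsto_one_of_eventually_le {ι : Type*} {l : Filter ι} {F a : ι → ℝ → ℝ} {G : ℝ → ℝ}
    {b : ι → ℝ} (hmono : ∀ v, Monotone (F v)) (hle : ∀ v y, F v y ≤ 1)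
    (hconv : ∀ y, Tendsto (fun v => F v (a v y)) l (𝓝 (G y))) (hG : Tendsto G atTop (𝓝 1))
    (hb : ∀ y, ∀ᶠ v in l, a v y ≤ b v) : Tendsto (fun v => F v (b v)) l (𝓝 1) := by
  refine tendsto_order.2 ⟨fun c hc => ?_, fun c hc => .of_forall fun v => (hle v _).trans_lt hc⟩
  obtain ⟨y, hy⟩ := (hG.eventually_const_lt hc).exists
  filter_upwards [(hconv y).eventually_const_lt hy, hb y] with v h1 h2
  exact h1.trans_le (hmono v h2)

/-- Distribution functions evaluated eventually below every point of a convergent normalization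
tend to zero. -/
lemma tendsto_zero_of_eventually_le {ι : Type*} {l : Filter ι} {F a : ι → ℝ → ℝ} {G : ℝ → ℝ}
    {b : ι → ℝ} (hmono : ∀ v, Monotone (F v)) (hnonneg : ∀ v y, 0 ≤ F v y)
    (hconv : ∀ y, Tendsto (fun v => F v (a v y)) l (𝓝 (G y))) (hG : Tendsto G atBot (𝓝 0))
    (hb : ∀ y, ∀ᶠ v in l, b v ≤ a v y) : Tendsto (fun v => F v (b v)) l (𝓝 0) := by
  refine tendsto_order.2
    ⟨fun c hc => .of_forall fun v => hc.trans_le (hnonneg v _), fun c hc => ?_⟩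
  obtain ⟨y, hy⟩ := (hG.eventually_lt_const hc).exists
  filter_upwards [(hconv y).eventually_lt_const hy, hb y] with v h1 h2
  exact (hmono v h2).trans_lt h1

/-- Example 6 (mixtures from the canonical Heffernan–Tawn model): if `π₁, π₂` are
transition kernels (given by their conditional distribution functions) on the standard
exponential scale stabilizing under Heffernan–Tawn normalizations with parameters
`(α₁,β₁)` resp. `(α₂,β₂)`, `α₁ > α₂`, and limits `G₁, G₂` (non-degenerate, with continuous
distribution functions), then the mixture `π = λπ₁ + (1-λ)π₂` converges weakly on the
extended real line with two distinct normalizations: pointwise in `x`,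
`π(v, α₁v + v^{β₁}x) → (1-λ) + λG₁(x)` (i.e. `K₁ = λG₁ + (1-λ)δ_{-∞}`) and
`π(v, α₂v + v^{β₂}x) → (1-λ)G₂(x)` (i.e. `K₂ = (1-λ)G₂ + λδ_{+∞}`). -/
theorem extreme_events_ht_mixture
    (α1 α2 β1 β2 lam : ℝ)
    (hα1 : α1 ∈ Set.Ioo (0 : ℝ) 1) (hα2 : α2 ∈ Set.Ioo (0 : ℝ) 1) (hα : α2 < α1)
    (hβ1 : β1 ∈ Set.Ico (0 : ℝ) 1) (hβ2 : β2 ∈ Set.Ico (0 : ℝ) 1)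
    (hlam : lam ∈ Set.Ioo (0 : ℝ) 1)
    -- the kernels, given by conditional distribution functions `y ↦ πᵢ v y`
    (π1 π2 : ℝ → ℝ → ℝ)
    (hπ1mono : ∀ v, Monotone (π1 v)) (hπ2mono : ∀ v, Monotone (π2 v))
    (hπ1bds : ∀ v y, π1 v y ∈ Set.Icc (0 : ℝ) 1) (hπ2bds : ∀ v y, π2 v y ∈ Set.Icc (0 : ℝ) 1)
    (hπ1top : ∀ v, Tendsto (π1 v) atTop (𝓝 1)) (hπ1bot : ∀ v, Tendsto (π1 v) atBot (𝓝 0))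
    (hπ2top : ∀ v, Tendsto (π2 v) atTop (𝓝 1)) (hπ2bot : ∀ v, Tendsto (π2 v) atBot (𝓝 0))
    -- non-degenerate limit distribution functions `G₁, G₂`, continuous on `ℝ`
    (G1 G2 : ℝ → ℝ)
    (hG1mono : Monotone G1) (hG2mono : Monotone G2)
    (hG1cont : Continuous G1) (hG2cont : Continuous G2)
    (hG1top : Tendsto G1 atTop (𝓝 1)) (hG1bot : Tendsto G1 atBot (𝓝 0))
    (hG2top : Tendsto G2 atTop (𝓝 1)) (hG2bot : Tendsto G2 atBot (𝓝 0))
    (hG1nondeg : ¬∃ x0 : ℝ, ∀ x, G1 x = if x0 ≤ x then 1 else 0)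
    (hG2nondeg : ¬∃ x0 : ℝ, ∀ x, G2 x = if x0 ≤ x then 1 else 0)
    -- the Heffernan–Tawn stabilizations of `π₁` and `π₂`
    (hπ1conv : ∀ x : ℝ,
      Tendsto (fun v => π1 v (α1 * v + v ^ β1 * x)) atTop (𝓝 (G1 x)))
    (hπ2conv : ∀ x : ℝ,
      Tendsto (fun v => π2 v (α2 * v + v ^ β2 * x)) atTop (𝓝 (G2 x))) :
    (∀ x : ℝ,
      Tendsto (fun v => lam * π1 v (α1 * v + v ^ β1 * x)
          + (1 - lam) * π2 v (α1 * v + v ^ β1 * x)) atTop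
        (𝓝 ((1 - lam) + lam * G1 x))) ∧
    (∀ x : ℝ,
      Tendsto (fun v => lam * π1 v (α2 * v + v ^ β2 * x)
          + (1 - lam) * π2 v (α2 * v + v ^ β2 * x)) atTop
        (𝓝 ((1 - lam) * G2 x))) := by
  refine ⟨fun x => ?_, fun x => ?_⟩
  · have h2 := tendsto_one_of_eventually_le hπ2mono (fun v y => (hπ2bds v y).2) hπ2conv hG2top
      (fun y => eventually_linear_add_rpow_le hα hβ2.2 hβ1.2 x y)
    simpa [add_comm] using ((hπ1conv x).const_mul lam).add (h2.const_mul (1 - lam))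
  · have h1 := tendsto_zero_of_eventually_le hπ1mono (fun v y => (hπ1bds v y).1) hπ1conv hG1bot
      (fun y => eventually_linear_add_rpow_le hα hβ2.2 hβ1.2 y x)
    simpa using (h1.const_mul lam).add ((hπ2conv x).const_mul (1 - lam))
end

section
/- Let α_−, α_+ ∈ (−1,0) and β ∈ [0,1), and define the negative-dependence Heffernan–Tawn t-step normings a_t(v) = α_−^{(t+1)/2} α_+^{(t−1)/2} v for t odd, a_t(v) = α_−^{t/2} α_+^{t/2} v for t even, and b_t(v) = |v|^β, with one-step normings a^{(t)}(w) = α_+ w for t odd and a^{(t)}(w) = α_− w for t even, and b^{(t)}(w) = |w|^β. Then for every t ≥ 1, as v ↑ ∞: (i) [a^{(t)}(a_t(v)+b_t(v)x) − a_{t+1}(v)]/b_{t+1}(v) converges to α_+ x for t odd and to α_− x for t even; and (ii) b^{(t)}(a_t(v)+b_t(v)x)/b_{t+1}(v) converges to |α_−^{(t+1)/2} α_+^{(t−1)/2}|^β for t odd and to |α_−^{t/2} α_+^{t/2}|^β for t even; with both convergences holding uniformly on compact sets in x ∈ ℝ. Hence assumption C2 holds and the tail chain is M_{t+1} = α_+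 M_t + |α_−^{(t+1)/2} α_+^{(t−1)/2}|^β ε_{t+1}^+ for t odd and M_{t+1} = α_− M_t + |α_−^{t/2} α_+^{t/2}|^β ε_{t+1}^− for t even. -/
open Filter Topology

/-- The coefficient of the `t`-step location norming in the negative-dependence
Heffernan–Tawn scheme: `α₋^{(t+1)/2} α₊^{(t-1)/2}` for `t` odd and `α₋^{t/2} α₊^{t/2}`
for `t` even. -/
noncomputable def negHTcoef (am ap : ℝ) (t : ℕ) : ℝ :=
  if Odd t then am ^ ((t + 1) / 2) * ap ^ ((t - 1) / 2) else am ^ (t / 2) * ap ^ (t / 2)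

/-- Multiplying by the one-step coefficient turns the `t`-step coefficient into the
`(t + 1)`-step one. -/
theorem mul_negHTcoef (am ap : ℝ) (t : ℕ) :
    (if Odd t then ap else am) * negHTcoef am ap t = negHTcoef am ap (t + 1) := by
  rcases Nat.even_or_odd' t with ⟨k, rfl | rfl⟩
  · have h₁ : (2 * k + 1 + 1) / 2 = k + 1 := by omega
    have h₂ : ¬ Odd (2 * k) := by simp
    simp [negHTcoef, h₁, h₂, pow_succ]
    ring
  · have h₁ : (2 * k + 1 + 1) / 2 = k + 1 := by omega
    have h₂ : ¬ Odd (2 * k + 1 + 1) := by simp [parity_simps]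
    simp [negHTcoef, h₁, h₂, pow_succ]
    ring

/-- For `0 ≤ β`, the map `x ↦ |c + s x| ^ β` tends to the constant `|c| ^ β` uniformly on
compact sets as `s → 0`. -/
theorem tendstoUniformlyOn_abs_add_mul_rpow {β : ℝ} (hβ : 0 ≤ β) (c : ℝ) {C : Set ℝ}
    (hC : IsCompact C) :
    TendstoUniformlyOn (fun s x : ℝ => |c + s * x| ^ β) (fun _ => |c| ^ β) (𝓝 0) C := by
  have hcont : Continuous (Function.uncurry fun s x : ℝ => |c + s * x| ^ β) :=
    Continuous.rpow_const (by fun_prop) fun _ => Or.inr hβ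
  intro u hu
  obtain ⟨w, hw, hwu⟩ := hC.mem_uniformity_of_prod (s := Set.univ) (q := (0 : ℝ))
    hcont.continuousOn (Set.mem_univ _) (symm_le_uniformity hu)
  rw [nhdsWithin_univ] at hw
  filter_upwards [hw] with s hs x hx
  simpa using hwu s hs x hx

/-- Dividing by the scale `v ^ β` inside the power `β`. -/
theorem abs_mul_add_rpow_div {β v : ℝ} (hv : 0 < v) (c x : ℝ) :
    |c * v + |v| ^ β * x| ^ β / |v| ^ β = |c + v ^ (-(1 - β)) * x| ^ β := by
  have h : c * v + |v| ^ β * x = v * (c + v ^ (-(1 - β)) * x) := by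
    have hp : v * v ^ (-(1 - β)) = v ^ β := by
      rw [mul_comm, ← Real.rpow_add_one hv.ne']
      ring_nf
    rw [abs_of_pos hv, mul_add, ← mul_assoc, hp, mul_comm c]
  rw [h, abs_mul, Real.mul_rpow (abs_nonneg _) (abs_nonneg _),
    mul_div_cancel_left₀ _ (Real.rpow_pos_of_pos (abs_pos.2 hv.ne') β).ne']

/-- Example (Heffernan–Tawn normalization in case of negative dependence): for
`α₋, α₊ ∈ (-1,0)`, `β ∈ [0,1)`, with `a_t(v) = negHTcoef α₋ α₊ t * v`, `b_t(v) = |v|^β`,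
one-step normings `a^{(t)}(w) = α₊ w` for `t` odd, `α₋ w` for `t` even, and
`b^{(t)}(w) = |w|^β`, for every `t ≥ 1` the update ratios converge uniformly on compact
sets in `x`: (i) `[a^{(t)}(a_t(v)+b_t(v)x) - a_{t+1}(v)]/b_{t+1}(v) → α₊ x` (`t` odd)
resp. `α₋ x` (`t` even); (ii) `b^{(t)}(a_t(v)+b_t(v)x)/b_{t+1}(v) → |negHTcoef α₋ α₊ t|^β`.
Hence assumption C2 holds with `ψ^a_{t+1}(x) = α₊ x` (`t` odd) / `α₋ x` (`t` even) and
`ψ^b_{t+1}(x) = |negHTcoef α₋ α₊ t|^β`. -/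
theorem extreme_events_heffernan_tawn_negdep_norming
    (am ap β : ℝ) (ham : am ∈ Set.Ioo (-1 : ℝ) 0) (hap : ap ∈ Set.Ioo (-1 : ℝ) 0)
    (hβ : β ∈ Set.Ico (0 : ℝ) 1) :
    ∀ t : ℕ, 1 ≤ t → ∀ C : Set ℝ, IsCompact C →
      -- (i) convergence of the location update ratio
      TendstoUniformlyOn
        (fun v x => ((if Odd t then ap else am) * (negHTcoef am ap t * v + |v| ^ β * x)
            - negHTcoef am ap (t + 1) * v) / |v| ^ β)
        (fun x => (if Odd t then ap else am) * x) atTop C ∧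
      -- (ii) convergence of the scale update ratio
      TendstoUniformlyOn
        (fun v x => |negHTcoef am ap t * v + |v| ^ β * x| ^ β / |v| ^ β)
        (fun _ => |negHTcoef am ap t| ^ β) atTop C := by
  intro t _ C hC
  constructor
  · intro u hu
    filter_upwards [eventually_gt_atTop 0] with v hv x _
    have hb : |v| ^ β ≠ 0 := (Real.rpow_pos_of_pos (abs_pos.2 hv.ne') β).ne'
    have h : ((if Odd t then ap else am) * (negHTcoef am ap t * v + |v| ^ β * x)
        - negHTcoef am ap (t + 1) * v) / |v| ^ β = (if Odd t then ap else am) * x := by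
      rw [← mul_negHTcoef, div_eq_iff hb]
      ring
    rw [h]
    exact refl_mem_uniformity hu
  · intro u hu
    have hs : Tendsto (fun v : ℝ => v ^ (-(1 - β))) atTop (𝓝 0) :=
      tendsto_rpow_neg_atTop (sub_pos.2 hβ.2)
    filter_upwards [eventually_gt_atTop 0,
      hs.eventually (tendstoUniformlyOn_abs_add_mul_rpow hβ.1 (negHTcoef am ap t) hC u hu)]
      with v hv hvu x hx
    rw [abs_mul_add_rpow_div hv]
    exact hvu x hx
end
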